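/- arXiv:2410.15070 — 4 statements merged into one kernel-verified Lean document; each statement's English description precedes it below -/
import Mathlib

section
/- Let q = p^s with p prime and s > 1, let 0 < i < s with m = gcd(i, s), and suppose p^m ≥ 3. Let h = (q − p^i)/2, or let p be odd and h = (p^i − 1)/2. Then the codewords of Hamming weight 4 in the BCH code C_h support a 3-(q+1, 4, p^m − 2) design: for every 3-element subset T of {0, 1, …, q}, the number of 4-element subsets S of {0, 1, …, q} with T ⊆ S such that S is the support of some codeword of C_h equals p^m − 2. -/
section Weights

variable {K : Type*} [Field K]

/-- Four weights annihilating `1, x, φ x, x * φ x` at `a, b, c, d` satisfy the two-term relation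
obtained by testing against `(x - a) * φ (x - b)`. -/
theorem two_term_relation (φ : K →+* K) {a b c d wa wb wc wd : K}
    (h₀ : wa + wb + wc + wd = 0)
    (h₁ : wa * a + wb * b + wc * c + wd * d = 0)
    (h₂ : wa * φ a + wb * φ b + wc * φ c + wd * φ d = 0)
    (h₃ : wa * (a * φ a) + wb * (b * φ b) + wc * (c * φ c) + wd * (d * φ d) = 0) :
    wc * ((c - a) * φ (c - b)) + wd * ((d - a) * φ (d - b)) = 0 := by
  simp only [map_sub]
  linear_combination h₃ - a * h₂ - φ b * h₁ + a * φ b * h₀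

/-- The cross-ratio of `d` with respect to `a, b, c`, normalised by `a ↦ 0`, `c ↦ 1`, `b ↦ ∞`. -/
def crossRatio (a b c d : K) : K := (d - a) * (c - b) / ((d - b) * (c - a))

theorem map_crossRatio_eq_self (φ : K →+* K) {a b c d wa wb wc wd : K}
    (hac : a ≠ c) (hbd : b ≠ d) (hwd : wd ≠ 0)
    (h₀ : wa + wb + wc + wd = 0)
    (h₁ : wa * a + wb * b + wc * c + wd * d = 0)
    (h₂ : wa * φ a + wb * φ b + wc * φ c + wd * φ d = 0)
    (h₃ : wa * (a * φ a) + wb * (b * φ b) + wc * (c * φ c) + wd * (d * φ d) = 0) :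
    φ (crossRatio a b c d) = crossRatio a b c d := by
  have e₁ := two_term_relation φ h₀ h₁ h₂ h₃
  have e₂ := two_term_relation φ (a := b) (b := a) (c := c) (d := d) (wa := wb) (wb := wa)
    (wc := wc) (wd := wd) (by linear_combination h₀) (by linear_combination h₁)
    (by linear_combination h₂) (by linear_combination h₃)
  have n₁ : c - a ≠ 0 := sub_ne_zero.2 hac.symm
  have n₂ : d - b ≠ 0 := sub_ne_zero.2 hbd.symm
  have n₃ : φ (c - a) ≠ 0 := (map_ne_zero φ).2 n₁
  have n₄ : φ (d - b) ≠ 0 := (map_ne_zero φ).2 n₂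
  simp only [crossRatio, map_div₀, map_mul]
  rw [div_eq_div_iff (mul_ne_zero n₄ n₃) (mul_ne_zero n₂ n₁)]
  apply mul_left_cancel₀ hwd
  linear_combination (φ (c - b) * (c - a)) * e₂ - ((c - b) * φ (c - a)) * e₁

/-- A norm-one element `x` satisfies `σ (x - y) = -(x - y) / (x * y)`. -/
theorem map_sub_of_map_mul_self_eq_one (σ : K →+* K) {x y : K} (hx : σ x * x = 1)
    (hy : σ y * y = 1) : σ (x - y) = -(x - y) / (x * y) := by
  have := right_ne_zero_of_mul_eq_one hx
  have := right_ne_zero_of_mul_eq_one hy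
  rw [eq_div_iff (by positivity), map_sub]
  linear_combination y * hx - x * hy

theorem map_crossRatio_of_norm_one (σ : K →+* K) {a b c d : K} (ha : σ a * a = 1)
    (hb : σ b * b = 1) (hc : σ c * c = 1) (hd : σ d * d = 1) :
    σ (crossRatio a b c d) = crossRatio a b c d := by
  have := right_ne_zero_of_mul_eq_one ha
  have := right_ne_zero_of_mul_eq_one hb
  have := right_ne_zero_of_mul_eq_one hc
  have := right_ne_zero_of_mul_eq_one hd
  simp only [crossRatio, map_div₀, map_mul, map_sub_of_map_mul_self_eq_one σ hd ha,
    map_sub_of_map_mul_self_eq_one σ hc hb, map_sub_of_map_mul_self_eq_one σ hd hb,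
    map_sub_of_map_mul_self_eq_one σ hc ha]
  field_simp

theorem crossRatio_injective {a b c d d' : K} (hab : a ≠ b) (hac : a ≠ c) (hbc : b ≠ c)
    (hd : b ≠ d) (hd' : b ≠ d') (h : crossRatio a b c d = crossRatio a b c d') : d = d' := by
  have n₁ : c - a ≠ 0 := sub_ne_zero.2 hac.symm
  have n₂ : d - b ≠ 0 := sub_ne_zero.2 hd.symm
  have n₃ : d' - b ≠ 0 := sub_ne_zero.2 hd'.symm
  have n₄ : c - b ≠ 0 := sub_ne_zero.2 hbc.symm
  have n₅ : a - b ≠ 0 := sub_ne_zero.2 hab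
  rw [crossRatio, crossRatio, div_eq_div_iff (by positivity) (by positivity)] at h
  have h' : ((c - b) * (c - a) * (a - b)) * (d - d') = 0 := by linear_combination h
  exact sub_eq_zero.1 ((mul_eq_zero.1 h').resolve_left (by positivity))

theorem crossRatio_ne_zero {a b c d : K} (hac : a ≠ c) (hbc : b ≠ c) (had : a ≠ d)
    (hbd : b ≠ d) : crossRatio a b c d ≠ 0 :=
  div_ne_zero (mul_ne_zero (sub_ne_zero.2 had.symm) (sub_ne_zero.2 hbc.symm))
    (mul_ne_zero (sub_ne_zero.2 hbd.symm) (sub_ne_zero.2 hac.symm))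

theorem crossRatio_self {a b c : K} (hac : a ≠ c) (hbc : b ≠ c) : crossRatio a b c c = 1 := by
  have n₁ : c - a ≠ 0 := sub_ne_zero.2 hac.symm
  have n₄ : c - b ≠ 0 := sub_ne_zero.2 hbc.symm
  rw [crossRatio]; field_simp

/-- Every `σ`-fixed value other than `0, 1` is the cross-ratio of a norm-one point. -/
theorem exists_crossRatio_eq (σ : K →+* K) {a b c l : K} (ha : σ a * a = 1)
    (hb : σ b * b = 1) (hc : σ c * c = 1) (hab : a ≠ b) (hac : a ≠ c) (hbc : b ≠ c)
    (hl : σ l = l) (hl₀ : l ≠ 0) (hl₁ : l ≠ 1) :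
    ∃ d, σ d * d = 1 ∧ a ≠ d ∧ b ≠ d ∧ c ≠ d ∧ crossRatio a b c d = l := by
  have a₀ := right_ne_zero_of_mul_eq_one ha
  have b₀ := right_ne_zero_of_mul_eq_one hb
  have c₀ := right_ne_zero_of_mul_eq_one hc
  have n₁ : c - a ≠ 0 := sub_ne_zero.2 hac.symm
  have n₄ : c - b ≠ 0 := sub_ne_zero.2 hbc.symm
  have n₅ : a - b ≠ 0 := sub_ne_zero.2 hab
  have ia : σ a = a⁻¹ := eq_inv_of_mul_eq_one_left ha
  have ib : σ b = b⁻¹ := eq_inv_of_mul_eq_one_left hb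
  have ic : σ c = c⁻¹ := eq_inv_of_mul_eq_one_left hc
  set N := a * (c - b) - l * b * (c - a) with hN
  set D := (c - b) - l * (c - a) with hD
  have σN : σ N = -D / (a * b * c) := by
    simp only [hN, hD, map_sub, map_mul, ia, ib, ic, hl]; field_simp; ring
  have σD : σ D = -N / (a * b * c) := by
    simp only [hN, hD, map_sub, map_mul, ia, ib, ic, hl]; field_simp; ring
  have D₀ : D ≠ 0 := by
    intro h
    have hN₀ : N = 0 := by
      rw [h, map_zero, eq_comm, div_eq_zero_iff] at σD
      exact neg_eq_zero.1 (σD.resolve_right (by positivity))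
    have : (a - b) * (c - b) = 0 := by
      linear_combination hN₀ - hN - b * h + b * hD
    exact mul_ne_zero n₅ n₄ this
  have N₀ : N ≠ 0 := by
    intro h
    rw [h, map_zero, eq_comm, div_eq_zero_iff] at σN
    exact D₀ (neg_eq_zero.1 (σN.resolve_right (by positivity)))
  have da : N / D - a = l * (c - a) * (a - b) / D := by
    rw [eq_div_iff D₀, sub_mul, div_mul_cancel₀ _ D₀]; ring
  have db : N / D - b = (c - b) * (a - b) / D := by
    rw [eq_div_iff D₀, sub_mul, div_mul_cancel₀ _ D₀]; ring
  have hbd : b ≠ N / D := (sub_ne_zero.1 (by rw [db]; positivity)).symm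
  have hcr : crossRatio a b c (N / D) = l := by
    rw [crossRatio, da, db]; field_simp
  refine ⟨N / D, ?_, (sub_ne_zero.1 (by rw [da]; positivity)).symm, hbd, ?_, hcr⟩
  · rw [map_div₀, σN, σD]; field_simp
  · intro h
    rw [← h, crossRatio_self hac hbc] at hcr
    exact hl₁ hcr.symm

theorem weight_ne_zero (φ : K →+* K) {a b c d wa wb wc wd : K}
    (hda : d ≠ a) (hdb : d ≠ b) (hwd : wd ≠ 0)
    (h₀ : wa + wb + wc + wd = 0)
    (h₁ : wa * a + wb * b + wc * c + wd * d = 0)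
    (h₂ : wa * φ a + wb * φ b + wc * φ c + wd * φ d = 0)
    (h₃ : wa * (a * φ a) + wb * (b * φ b) + wc * (c * φ c) + wd * (d * φ d) = 0) :
    wc ≠ 0 := by
  rintro rfl
  have := two_term_relation φ h₀ h₁ h₂ h₃
  have n₁ : d - a ≠ 0 := sub_ne_zero.2 hda
  have n₂ : φ (d - b) ≠ 0 := (map_ne_zero φ).2 (sub_ne_zero.2 hdb)
  rw [zero_mul, zero_add] at this
  exact mul_ne_zero hwd (mul_ne_zero n₁ n₂) this

/-- The weights attached to four norm-one points with `φ`-fixed cross-ratio; the last one is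
prescribed. -/
theorem exists_weights (φ σ : K →+* K) (hcomm : ∀ x, σ (φ x) = φ (σ x)) {a b c d wd : K}
    (ha : σ a * a = 1) (hb : σ b * b = 1) (hc : σ c * c = 1) (hd : σ d * d = 1)
    (hab : a ≠ b) (hac : a ≠ c) (hbc : b ≠ c) (had : a ≠ d) (hbd : b ≠ d) (hcd : c ≠ d)
    (hφ : φ (crossRatio a b c d) = crossRatio a b c d)
    (hwd : wd ≠ 0) (hσ : σ wd = wd * (d * φ d)) :
    ∃ wa wb wc : K, wa ≠ 0 ∧ wb ≠ 0 ∧ wc ≠ 0 ∧ σ wa = wa * (a * φ a) ∧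
      σ wb = wb * (b * φ b) ∧ σ wc = wc * (c * φ c) ∧
      wa + wb + wc + wd = 0 ∧
      wa * a + wb * b + wc * c + wd * d = 0 ∧
      wa * φ a + wb * φ b + wc * φ c + wd * φ d = 0 ∧
      wa * (a * φ a) + wb * (b * φ b) + wc * (c * φ c) + wd * (d * φ d) = 0 := by
  have a₀ := right_ne_zero_of_mul_eq_one ha
  have b₀ := right_ne_zero_of_mul_eq_one hb
  have c₀ := right_ne_zero_of_mul_eq_one hc
  have d₀ := right_ne_zero_of_mul_eq_one hd
  have a₁ : φ a ≠ 0 := (map_ne_zero φ).2 a₀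
  have b₁ : φ b ≠ 0 := (map_ne_zero φ).2 b₀
  have c₁ : φ c ≠ 0 := (map_ne_zero φ).2 c₀
  have d₁ : φ d ≠ 0 := (map_ne_zero φ).2 d₀
  have σsub {x y : K} (hx : σ x * x = 1) (hy : σ y * y = 1) :
      σ (φ (x - y)) = -φ (x - y) / (φ x * φ y) := by
    rw [hcomm, map_sub_of_map_mul_self_eq_one σ hx hy, map_div₀, map_neg, map_mul]
  have n {x y : K} (h : x ≠ y) : y - x ≠ 0 := sub_ne_zero.2 h.symm
  have nφ {x y : K} (h : x ≠ y) : φ (y - x) ≠ 0 := (map_ne_zero φ).2 (n h)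
  have m₁ := n hac
  have m₂ := n hbc
  have m₃ := n had
  have m₄ := n hbd
  have m₅ := n hab
  have k₁ := nφ hac
  have k₂ := nφ hbc
  have k₃ := nφ had
  have k₄ := nφ hbd
  have k₅ := nφ hab
  have hrel : (d - a) * φ (d - b) * ((c - b) * φ (c - a)) =
      (d - b) * φ (d - a) * ((c - a) * φ (c - b)) := by
    simp only [crossRatio, map_div₀, map_mul] at hφ
    rw [div_eq_div_iff (by positivity) (by positivity)] at hφ
    linear_combination -hφ
  obtain ⟨wc, hwc⟩ : ∃ wc, wc = -(wd * ((d - a) * φ (d - b))) / ((c - a) * φ (c - b)) := ⟨_, rfl⟩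
  obtain ⟨wa, hwa⟩ : ∃ wa, wa = -(wc * ((c - b) * φ (c - b)) + wd * ((d - b) * φ (d - b))) /
    ((b - a) * φ (b - a)) := ⟨_, rfl⟩
  obtain ⟨wb, hwb⟩ : ∃ wb, wb = -(wc * ((c - a) * φ (c - a)) + wd * ((d - a) * φ (d - a))) /
    ((b - a) * φ (b - a)) := ⟨_, rfl⟩
  have σc : σ wc = wc * (c * φ c) := by
    rw [hwc]
    simp only [map_div₀, map_mul, map_neg, hσ, map_sub_of_map_mul_self_eq_one σ hd ha,
      map_sub_of_map_mul_self_eq_one σ hc ha, σsub hd hb, σsub hc hb]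
    field_simp
  have σa : σ wa = wa * (a * φ a) := by
    rw [hwa]
    simp only [map_div₀, map_mul, map_neg, map_add, hσ, σc,
      map_sub_of_map_mul_self_eq_one σ hd hb, map_sub_of_map_mul_self_eq_one σ hc hb,
      map_sub_of_map_mul_self_eq_one σ hb ha, σsub hd hb, σsub hc hb, σsub hb ha]
    field_simp
  have σb : σ wb = wb * (b * φ b) := by
    rw [hwb]
    simp only [map_div₀, map_mul, map_neg, map_add, hσ, σc,
      map_sub_of_map_mul_self_eq_one σ hd ha, map_sub_of_map_mul_self_eq_one σ hc ha,
      map_sub_of_map_mul_self_eq_one σ hb ha, σsub hd ha, σsub hc ha, σsub hb ha]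
    field_simp
  have r₁ : wc * ((c - a) * φ (c - b)) + wd * ((d - a) * φ (d - b)) = 0 := by
    rw [hwc, div_mul_cancel₀ _ (by positivity)]; ring
  have r₂ : wc * ((c - b) * φ (c - a)) + wd * ((d - b) * φ (d - a)) = 0 := by
    apply mul_left_cancel₀ (mul_ne_zero m₁ k₂)
    linear_combination ((c - b) * φ (c - a)) * r₁ - wd * hrel
  have r₃ : wa * ((b - a) * φ (b - a)) + wc * ((c - b) * φ (c - b)) +
      wd * ((d - b) * φ (d - b)) = 0 := by
    rw [hwa, div_mul_cancel₀ _ (by positivity)]; ring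
  have r₄ : wb * ((b - a) * φ (b - a)) + wc * ((c - a) * φ (c - a)) +
      wd * ((d - a) * φ (d - a)) = 0 := by
    rw [hwb, div_mul_cancel₀ _ (by positivity)]; ring
  have nz : (b - a) * φ (b - a) ≠ 0 := mul_ne_zero m₅ k₅
  simp only [map_sub] at r₁ r₂ r₃ r₄ nz
  have h₀ : wa + wb + wc + wd = 0 := by
    apply mul_left_cancel₀ nz
    linear_combination r₃ + r₄ - r₁ - r₂
  have h₁ : wa * a + wb * b + wc * c + wd * d = 0 := by
    apply mul_left_cancel₀ nz
    linear_combination a * r₃ + b * r₄ - b * r₁ - a * r₂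
  have h₂ : wa * φ a + wb * φ b + wc * φ c + wd * φ d = 0 := by
    apply mul_left_cancel₀ nz
    linear_combination φ a * r₃ + φ b * r₄ - φ a * r₁ - φ b * r₂
  have h₃ : wa * (a * φ a) + wb * (b * φ b) + wc * (c * φ c) + wd * (d * φ d) = 0 := by
    apply mul_left_cancel₀ nz
    linear_combination a * φ a * r₃ + b * φ b * r₄ - b * φ a * r₁ - a * φ b * r₂
  refine ⟨wa, wb, wc, ?_, ?_, ?_, σa, σb, σc, h₀, h₁, h₂, h₃⟩
  · exact weight_ne_zero φ (a := b) (b := c) (c := a) (wa := wb) (wb := wc) (wc := wa)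
      hbd.symm hcd.symm hwd
      (by linear_combination h₀) (by linear_combination h₁) (by linear_combination h₂)
      (by linear_combination h₃)
  · exact weight_ne_zero φ (a := a) (b := c) (c := b) (wa := wa) (wb := wc) (wc := wb)
      had.symm hcd.symm hwd
      (by linear_combination h₀) (by linear_combination h₁) (by linear_combination h₂)
      (by linear_combination h₃)
  · exact weight_ne_zero φ had.symm hbd.symm hwd h₀ h₁ h₂ h₃

end Weights

open Polynomial in
theorem FiniteField.exists_algebraMap_eq_of_pow_card_eq {F K : Type*} [Field F] [Fintype F]
    [Field K] [Algebra F K] {x : K} (hx : x ^ Fintype.card F = x) :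
    ∃ y : F, algebraMap F K y = x := by
  classical
  have h0 : (X ^ Fintype.card F - X : K[X]) ≠ 0 :=
    FiniteField.X_pow_card_sub_X_ne_zero K Fintype.one_lt_card
  have hsub : Finset.univ.image (algebraMap F K) ⊆
      (X ^ Fintype.card F - X : K[X]).roots.toFinset := by
    intro z hz
    obtain ⟨y, -, rfl⟩ := Finset.mem_image.1 hz
    rw [Multiset.mem_toFinset, mem_roots h0]
    simp [← map_pow, FiniteField.pow_card]
  have hcard : (X ^ Fintype.card F - X : K[X]).roots.toFinset.card ≤
      (Finset.univ.image (algebraMap F K)).card := by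
    rw [Finset.card_image_of_injective _ (algebraMap F K).injective, Finset.card_univ]
    refine (Multiset.toFinset_card_le _).trans ((card_roots' _).trans_eq ?_)
    exact FiniteField.X_pow_card_sub_X_natDegree_eq K Fintype.one_lt_card
  have hxm : x ∈ (X ^ Fintype.card F - X : K[X]).roots.toFinset := by
    rw [Multiset.mem_toFinset, mem_roots h0]
    simp [hx]
  rw [← Finset.eq_of_subset_of_card_le hsub hcard] at hxm
  obtain ⟨y, -, hy⟩ := Finset.mem_image.1 hxm
  exact ⟨y, hy⟩

open Polynomial in
/-- Among the elements other than `0, 1`, the common fixed points of `x ↦ x ^ p ^ i` and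
`x ↦ x ^ p ^ s` number `p ^ gcd i s - 2`. -/
theorem ncard_setOf_pow_eq_self {K : Type*} [Field K] [Fintype K] {p s i : ℕ} (hp : p.Prime)
    (hs : s ≠ 0) (hK : Fintype.card K = (p ^ s) ^ 2) :
    {x : K | x ^ p ^ i = x ∧ x ^ p ^ s = x ∧ x ≠ 0 ∧ x ≠ 1}.ncard = p ^ Nat.gcd i s - 2 := by
  classical
  set n := p ^ Nat.gcd i s - 1 with hn
  have hg : Nat.gcd i s ≠ 0 := (Nat.gcd_pos_of_pos_right _ (Nat.pos_of_ne_zero hs)).ne'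
  have hn0 : 0 < n := Nat.sub_pos_of_lt (Nat.one_lt_pow hg hp.one_lt)
  have hdvd : n ∣ Fintype.card K - 1 := by
    rw [hK, ← pow_mul]
    exact Nat.pow_sub_one_dvd_pow_sub_one _ (Dvd.dvd.mul_right (Nat.gcd_dvd_right i s) 2)
  obtain ⟨g, hgen⟩ := IsCyclic.exists_ofOrder_eq_natCard (α := Kˣ)
  rw [Nat.card_eq_fintype_card, Fintype.card_units] at hgen
  obtain ⟨k, hk⟩ := hdvd
  have hprim : IsPrimitiveRoot (((g : K)) ^ k) n := by
    have h1 : IsPrimitiveRoot (g : K) (Fintype.card K - 1) := by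
      rw [IsPrimitiveRoot.coe_units_iff, ← hgen]
      exact IsPrimitiveRoot.orderOf g
    refine h1.pow (Nat.sub_pos_of_lt Fintype.one_lt_card) (by rw [hk, mul_comm])
  have hpow : ∀ (x : K) (j : ℕ), x ≠ 0 → (x ^ p ^ j = x ↔ x ^ (p ^ j - 1) = 1) := by
    intro x j hx
    conv_lhs => rw [← Nat.sub_add_cancel (Nat.one_le_pow j p hp.pos), pow_succ]
    exact mul_eq_right₀ hx
  have hset : {x : K | x ^ p ^ i = x ∧ x ^ p ^ s = x ∧ x ≠ 0 ∧ x ≠ 1} =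
      ((nthRootsFinset n (1 : K)).erase 1 : Finset K) := by
    ext x
    simp only [Set.mem_ofPred_eq, Finset.coe_erase, Set.mem_sdiff, Finset.mem_coe,
      mem_nthRootsFinset hn0, Set.mem_singleton_iff]
    rw [hn, ← Nat.pow_sub_one_gcd_pow_sub_one, pow_gcd_eq_one]
    constructor
    · rintro ⟨h1, h2, h3, h4⟩
      exact ⟨⟨(hpow x i h3).1 h1, (hpow x s h3).1 h2⟩, h4⟩
    · rintro ⟨⟨h1, h2⟩, h4⟩
      have h3 : x ≠ 0 := by
        rintro rfl
        rw [zero_pow] at h2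
        · exact zero_ne_one h2
        · exact (Nat.sub_pos_of_lt (Nat.one_lt_pow hs hp.one_lt)).ne'
      exact ⟨(hpow x i h3).2 h1, (hpow x s h3).2 h2, h3, h4⟩
  rw [hset, Set.ncard_coe_finset, Finset.card_erase_of_mem, hprim.card_nthRootsFinset, hn]
  · omega
  · rw [mem_nthRootsFinset hn0, one_pow]

theorem sum_mul_pow_eq_four {F K : Type*} [Field F] [Field K] [Algebra F K]
    {N : ℕ} (β : K) {c : Fin N → F} {ja jb jc jd : Fin N}
    (hab : ja ≠ jb) (hac : ja ≠ jc) (hbc : jb ≠ jc) (had : ja ≠ jd) (hbd : jb ≠ jd)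
    (hcd : jc ≠ jd) (hc : ∀ j, j ≠ ja → j ≠ jb → j ≠ jc → j ≠ jd → c j = 0) (n : ℕ) :
    ∑ j, algebraMap F K (c j) * β ^ (n * (j : ℕ)) =
      algebraMap F K (c ja) * (β ^ (ja : ℕ)) ^ n + algebraMap F K (c jb) * (β ^ (jb : ℕ)) ^ n +
      algebraMap F K (c jc) * (β ^ (jc : ℕ)) ^ n + algebraMap F K (c jd) * (β ^ (jd : ℕ)) ^ n := by
  rw [← Finset.sum_subset (Finset.subset_univ {ja, jb, jc, jd})]
  · rw [Finset.sum_insert (by simp [*]), Finset.sum_insert (by simp [*]),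
      Finset.sum_insert (by simp [*]), Finset.sum_singleton]
    simp only [← pow_mul, mul_comm n, add_assoc]
  · intro j _ hj
    simp only [Finset.mem_insert, Finset.mem_singleton, not_or] at hj
    rw [hc j hj.1 hj.2.1 hj.2.2.1 hj.2.2.2, map_zero, zero_mul]

section Code

variable {F K : Type*} [Field F] [Fintype F] [Field K] [Algebra F K]

/-- Applying `x ↦ x ^ #F` to a parity check negates its exponent modulo the order of `β`. -/
theorem parity_check_of_dvd_add {β : K} {N n n' : ℕ} (hβ : β ^ N = 1)
    (hN : N = Fintype.card F + 1) (hdvd : N ∣ n + n') {c : Fin N → F}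
    (hc : ∑ j, algebraMap F K (c j) * β ^ (n * (j : ℕ)) = 0) :
    ∑ j, algebraMap F K (c j) * β ^ (n' * (j : ℕ)) = 0 := by
  have h := congrArg (FiniteField.frobeniusAlgHom F K) hc
  rw [map_sum, map_zero] at h
  rw [← h]
  refine Finset.sum_congr rfl fun j _ => ?_
  rw [map_mul, AlgHom.commutes, pow_mul, pow_mul, map_pow, FiniteField.coe_frobeniusAlgHom]
  congr 2
  have hβ₀ : β ≠ 0 := by
    rintro rfl
    rw [hN, zero_pow (Nat.succ_ne_zero _)] at hβ
    exact zero_ne_one hβ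
  obtain ⟨k, hk⟩ := hdvd
  have h₁ : β ^ n * β ^ n' = 1 := by rw [← pow_add, hk, pow_mul, hβ, one_pow]
  have h₂ : β ^ n * (β ^ n) ^ Fintype.card F = 1 := by
    rw [← pow_succ', ← hN, ← pow_mul, mul_comm, pow_mul, hβ, one_pow]
  exact mul_left_cancel₀ (pow_ne_zero n hβ₀) (h₁.trans h₂.symm)

/-- Four positions support a codeword precisely when their cross-ratio is fixed by
`x ↦ x ^ p ^ i`. -/
theorem exists_codeword_support_iff [DecidableEq F] {p : ℕ} [Fact p.Prime] [CharP K p]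
    {i e N : ℕ} {β : K} (hN : N = Fintype.card F + 1) (hβ : IsPrimitiveRoot β N)
    (hdvd : N ∣ 2 * e + p ^ i + 1) {ja jb jc jd : Fin N}
    (hab : ja ≠ jb) (hac : ja ≠ jc) (hbc : jb ≠ jc) (had : ja ≠ jd) (hbd : jb ≠ jd)
    (hcd : jc ≠ jd) :
    (∃ c : Fin N → F, (∑ j, algebraMap F K (c j) * β ^ (e * (j : ℕ)) = 0 ∧
        ∑ j, algebraMap F K (c j) * β ^ ((e + 1) * (j : ℕ)) = 0) ∧
        (Finset.univ.filter fun j => c j ≠ 0) = {jd, ja, jb, jc}) ↔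
      crossRatio (β ^ (ja : ℕ)) (β ^ (jb : ℕ)) (β ^ (jc : ℕ)) (β ^ (jd : ℕ)) ^ p ^ i =
        crossRatio (β ^ (ja : ℕ)) (β ^ (jb : ℕ)) (β ^ (jc : ℕ)) (β ^ (jd : ℕ)) := by
  have hne : ∀ {j k : Fin N}, j ≠ k → β ^ (j : ℕ) ≠ β ^ (k : ℕ) := fun h h' =>
    h (Fin.ext (hβ.pow_inj (Fin.is_lt _) (Fin.is_lt _) h'))
  have hone : ∀ j : ℕ, (β ^ j) ^ N = 1 := fun j => by
    rw [← pow_mul, mul_comm, pow_mul, hβ.pow_eq_one, one_pow]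
  have hnz : ∀ j : ℕ, β ^ j ≠ 0 := fun j h => by
    have := hone j
    rw [h, hN, zero_pow (Nat.succ_ne_zero _)] at this
    exact zero_ne_one this
  constructor
  · rintro ⟨c, ⟨hc₁, hc₂⟩, hS⟩
    have hmem : ∀ j, c j ≠ 0 ↔ j = jd ∨ j = ja ∨ j = jb ∨ j = jc := fun j => by
      simpa using congrArg (j ∈ ·) hS
    have hc₃ := parity_check_of_dvd_add (n' := e + p ^ i + 1) hβ.pow_eq_one hN
      (by convert hdvd using 1; ring) hc₁
    have hc₄ := parity_check_of_dvd_add (n' := e + p ^ i) hβ.pow_eq_one hN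
      (by convert hdvd using 1; ring) hc₂
    have h0 : ∀ j, j ≠ ja → j ≠ jb → j ≠ jc → j ≠ jd → c j = 0 := fun j h₁ h₂ h₃ h₄ => by
      by_contra h
      rcases (hmem j).1 h with h | h | h | h <;> contradiction
    rw [sum_mul_pow_eq_four β hab hac hbc had hbd hcd h0] at hc₁ hc₂ hc₃ hc₄
    have hd : algebraMap F K (c jd) * (β ^ (jd : ℕ)) ^ e ≠ 0 :=
      mul_ne_zero ((map_ne_zero _).2 ((hmem jd).2 (Or.inl rfl))) (pow_ne_zero _ (hnz _))
    refine map_crossRatio_eq_self (iterateFrobenius K p i) (hne hac) (hne hbd) hd hc₁ ?_ ?_ ?_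
    · linear_combination hc₂
    · simp only [iterateFrobenius_def]
      linear_combination hc₄
    · simp only [iterateFrobenius_def]
      linear_combination hc₃
  · intro hφ
    have hσ : ∀ j : ℕ, FiniteField.frobeniusAlgHom F K (β ^ j) * β ^ j = 1 := fun j => by
      rw [FiniteField.coe_frobeniusAlgHom]
      dsimp only
      rw [← pow_succ, ← hN, hone]
    have hfac : ∀ j : ℕ, (β ^ j) ^ e * ((β ^ j) ^ e * (β ^ j * (β ^ j) ^ p ^ i)) = 1 := fun j => by
      obtain ⟨k, hk⟩ := hdvd
      calc _ = (β ^ j) ^ (2 * e + p ^ i + 1) := by ring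
        _ = 1 := by rw [hk, pow_mul, hone, one_pow]
    have hσe : ∀ j : ℕ, FiniteField.frobeniusAlgHom F K ((β ^ j) ^ e) =
        (β ^ j) ^ e * (β ^ j * (β ^ j) ^ p ^ i) := fun j => by
      refine mul_left_cancel₀ (pow_ne_zero e (hnz j)) ?_
      rw [hfac, map_pow, ← mul_pow, mul_comm, hσ, one_pow]
    have hcomm : ∀ x : K, (FiniteField.frobeniusAlgHom F K : K →+* K) (iterateFrobenius K p i x) =
        iterateFrobenius K p i ((FiniteField.frobeniusAlgHom F K : K →+* K) x) := fun x => by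
      simp only [iterateFrobenius_def, map_pow]
    obtain ⟨wa, wb, wc, ha₀, hb₀, hc₀, σa, σb, σc, h₀, h₁, h₂, h₃⟩ :=
      exists_weights (iterateFrobenius K p i) (FiniteField.frobeniusAlgHom F K : K →+* K) hcomm
        (wd := (β ^ (jd : ℕ)) ^ e) (hσ ja) (hσ jb) (hσ jc) (hσ jd) (hne hab) (hne hac) (hne hbc)
        (hne had) (hne hbd) (hne hcd) hφ (pow_ne_zero _ (hnz _)) (hσe jd)
    simp only [iterateFrobenius_def] at h₂ h₃
    have descend : ∀ (j : ℕ) (w : K), w ≠ 0 → FiniteField.frobeniusAlgHom F K w =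
        w * (β ^ j * (β ^ j) ^ p ^ i) → ∃ y : F, y ≠ 0 ∧ algebraMap F K y * (β ^ j) ^ e = w := by
      intro j w hw hw'
      have hje := pow_ne_zero e (hnz j)
      obtain ⟨y, hy⟩ := FiniteField.exists_algebraMap_eq_of_pow_card_eq (F := F)
        (x := w / (β ^ j) ^ e) (by
          have : FiniteField.frobeniusAlgHom F K (w / (β ^ j) ^ e) = w / (β ^ j) ^ e := by
            rw [map_div₀, hw', hσe, mul_div_mul_right]
            exact mul_ne_zero (hnz j) (pow_ne_zero _ (hnz j))
          exact this)
      refine ⟨y, ?_, by rw [hy, div_mul_cancel₀ _ hje]⟩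
      rintro rfl
      rw [map_zero, eq_comm, div_eq_zero_iff] at hy
      exact hy.elim hw hje
    obtain ⟨ya, hya₀, hya⟩ := descend ja wa ha₀ σa
    obtain ⟨yb, hyb₀, hyb⟩ := descend jb wb hb₀ σb
    obtain ⟨yc, hyc₀, hyc⟩ := descend jc wc hc₀ σc
    set c : Fin N → F := fun j =>
      if j = ja then ya else if j = jb then yb else if j = jc then yc else if j = jd then 1 else 0
      with hc
    have ca : c ja = ya := by simp [hc]
    have cb : c jb = yb := by simp [hc, hab.symm]
    have cc : c jc = yc := by simp [hc, hac.symm, hbc.symm]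
    have cd : c jd = 1 := by simp [hc, had.symm, hbd.symm, hcd.symm]
    have h0 : ∀ j, j ≠ ja → j ≠ jb → j ≠ jc → j ≠ jd → c j = 0 := fun j k₁ k₂ k₃ k₄ => by
      simp [hc, k₁, k₂, k₃, k₄]
    refine ⟨c, ⟨?_, ?_⟩, ?_⟩
    · rw [sum_mul_pow_eq_four β hab hac hbc had hbd hcd h0, ca, cb, cc, cd, hya, hyb, hyc,
        map_one, one_mul, h₀]
    · rw [sum_mul_pow_eq_four β hab hac hbc had hbd hcd h0, ca, cb, cc, cd, map_one, one_mul]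
      simp only [pow_succ, ← mul_assoc, hya, hyb, hyc, h₁]
    · ext j
      simp only [Finset.mem_filter, Finset.mem_univ, true_and, Finset.mem_insert,
        Finset.mem_singleton]
      constructor
      · intro hj
        by_contra! h
        exact hj (h0 j h.2.1 h.2.2.1 h.2.2.2 h.1)
      · rintro (rfl | rfl | rfl | rfl)
        · rw [cd]; exact one_ne_zero
        · rwa [ca]
        · rwa [cb]
        · rwa [cc]

end Code

theorem stmt9 (p s : ℕ) (hp : p.Prime) (hs : 1 < s) (q : ℕ) (hq : q = p ^ s)
    (i m : ℕ) (hi0 : 0 < i) (his : i < s) (hm : m = Nat.gcd i s) (hpm : 3 ≤ p ^ m)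
    (h : ℕ) (hh : 2 * h = q - p ^ i ∨ (Odd p ∧ 2 * h = p ^ i - 1))
    (F K : Type) [Field F] [Field K] [Fintype F] [Fintype K] [DecidableEq F]
    [Algebra F K] (hF : Fintype.card F = q) (hK : Fintype.card K = q ^ 2)
    (β : K) (hβ : IsPrimitiveRoot β (q + 1))
    (C : Set (Fin (q + 1) → F))
    (hC : C = {c | (∑ j : Fin (q + 1), algebraMap F K (c j) * β ^ (h * (j : ℕ)) = 0) ∧
      (∑ j : Fin (q + 1), algebraMap F K (c j) * β ^ ((h + 1) * (j : ℕ)) = 0)}) :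
    ∀ T : Finset (Fin (q + 1)), T.card = 3 →
      {S : Finset (Fin (q + 1)) | S.card = 4 ∧ T ⊆ S ∧
        ∃ c ∈ C, (Finset.univ.filter fun j => c j ≠ 0) = S}.ncard = p ^ m - 2 := by
  intro T hT
  have : Fact p.Prime := ⟨hp⟩
  have : CharP K p := charP_of_card_eq_prime_pow (f := s * 2) (by rw [hK, hq, pow_mul])
  have hN : q + 1 = Fintype.card F + 1 := by rw [hF]
  have hpi : p ^ i ≤ q := hq ▸ Nat.pow_le_pow_right hp.pos his.le
  have hpi₀ : 0 < p ^ i := Nat.pow_pos hp.pos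
  obtain ⟨e, hdvd, hCe⟩ : ∃ e, q + 1 ∣ 2 * e + p ^ i + 1 ∧
      ∀ c, c ∈ C ↔ (∑ j : Fin (q + 1), algebraMap F K (c j) * β ^ (e * (j : ℕ)) = 0 ∧
        ∑ j : Fin (q + 1), algebraMap F K (c j) * β ^ ((e + 1) * (j : ℕ)) = 0) := by
    rcases hh with hh | ⟨-, hh⟩
    · exact ⟨h, ⟨1, by omega⟩, fun c => by rw [hC]; rfl⟩
    · refine ⟨q - h, ⟨2, by omega⟩, fun c => ?_⟩
      rw [hC]
      have d₁ : q + 1 ∣ h + 1 + (q - h) := ⟨1, by omega⟩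
      have d₂ : q + 1 ∣ h + (q - h + 1) := ⟨1, by omega⟩
      constructor
      · rintro ⟨k₁, k₂⟩
        exact ⟨parity_check_of_dvd_add hβ.pow_eq_one hN d₁ k₂,
          parity_check_of_dvd_add hβ.pow_eq_one hN d₂ k₁⟩
      · rintro ⟨k₁, k₂⟩
        exact ⟨parity_check_of_dvd_add hβ.pow_eq_one hN (add_comm h _ ▸ d₂) k₂,
          parity_check_of_dvd_add hβ.pow_eq_one hN (add_comm (h + 1) _ ▸ d₁) k₁⟩
  obtain ⟨ja, jb, jc, hab, hac, hbc, rfl⟩ := Finset.card_eq_three.1 hT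
  have hne : ∀ {j k : Fin (q + 1)}, j ≠ k → β ^ (j : ℕ) ≠ β ^ (k : ℕ) := fun h h' =>
    h (Fin.ext (hβ.pow_inj (Fin.is_lt _) (Fin.is_lt _) h'))
  have hσ : ∀ j : ℕ, (FiniteField.frobeniusAlgHom F K : K →+* K) (β ^ j) * β ^ j = 1 := fun j => by
    change (β ^ j) ^ Fintype.card F * β ^ j = 1
    rw [← pow_succ, ← hN, ← pow_mul, mul_comm, pow_mul, hβ.pow_eq_one, one_pow]
  rw [hm, ← ncard_setOf_pow_eq_self hp (by omega : s ≠ 0) (hK.trans (by rw [hq])), eq_comm]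
  have point : ∀ l ∈ {x : K | x ^ p ^ i = x ∧ x ^ p ^ s = x ∧ x ≠ 0 ∧ x ≠ 1},
      ∃ jd : Fin (q + 1), ja ≠ jd ∧ jb ≠ jd ∧ jc ≠ jd ∧
        crossRatio (β ^ (ja : ℕ)) (β ^ (jb : ℕ)) (β ^ (jc : ℕ)) (β ^ (jd : ℕ)) = l := by
    rintro l ⟨-, hl, hl₀, hl₁⟩
    obtain ⟨d, hd, had, hbd, hcd, hcr⟩ := exists_crossRatio_eq
      (FiniteField.frobeniusAlgHom F K : K →+* K) (hσ ja) (hσ jb) (hσ jc) (hne hab) (hne hac)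
      (hne hbc) (by change l ^ Fintype.card F = l; rw [hF, hq, hl]) hl₀ hl₁
    change d ^ Fintype.card F * d = 1 at hd
    rw [← pow_succ, ← hN] at hd
    obtain ⟨k, hk, rfl⟩ := hβ.eq_pow_of_pow_eq_one hd
    refine ⟨⟨k, hk⟩, ?_, ?_, ?_, hcr⟩ <;> rintro rfl <;> contradiction
  choose! d had hbd hcd hcr using point
  refine Set.ncard_congr (fun l _ => insert (d l) {ja, jb, jc}) ?_ ?_ ?_
  · intro l hl
    refine ⟨?_, Finset.subset_insert _ _, ?_⟩
    · rw [Finset.card_insert_of_notMem, hT]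
      simp [(had l hl).symm, (hbd l hl).symm, (hcd l hl).symm]
    · simp only [hCe]
      exact (exists_codeword_support_iff hN hβ hdvd hab hac hbc (had l hl) (hbd l hl)
        (hcd l hl)).2 (by rw [hcr l hl]; exact hl.1)
  · intro l l' hl hl' heq
    have hmem : d l ∈ insert (d l') ({ja, jb, jc} : Finset (Fin (q + 1))) :=
      heq ▸ Finset.mem_insert_self _ _
    simp only [Finset.mem_insert, Finset.mem_singleton, (had l hl).symm, (hbd l hl).symm,
      (hcd l hl).symm, or_false] at hmem
    rw [← hcr l hl, hmem, hcr l' hl']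
  · rintro S ⟨hS, hTS, hc⟩
    obtain ⟨jd, hjd, rfl⟩ := Finset.exists_eq_insert_iff.2 ⟨hTS, by rw [hT, hS]⟩
    simp only [Finset.mem_insert, Finset.mem_singleton, not_or] at hjd
    obtain ⟨ha, hb, hc'⟩ := hjd
    simp only [hCe] at hc
    have hfix := (exists_codeword_support_iff hN hβ hdvd hab hac hbc (Ne.symm ha) (Ne.symm hb)
      (Ne.symm hc')).1 hc
    set l := crossRatio (β ^ (ja : ℕ)) (β ^ (jb : ℕ)) (β ^ (jc : ℕ)) (β ^ (jd : ℕ)) with hl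
    have hlmem : l ∈ {x : K | x ^ p ^ i = x ∧ x ^ p ^ s = x ∧ x ≠ 0 ∧ x ≠ 1} := by
      refine ⟨hfix, ?_, crossRatio_ne_zero (hne hac) (hne hbc) (hne (Ne.symm ha))
        (hne (Ne.symm hb)), ?_⟩
      · rw [← hq, ← hF]
        exact map_crossRatio_of_norm_one (FiniteField.frobeniusAlgHom F K : K →+* K) (hσ ja)
          (hσ jb) (hσ jc) (hσ jd)
      · intro h1
        rw [hl, ← crossRatio_self (hne hac) (hne hbc)] at h1
        exact hne hc' (crossRatio_injective (hne hab) (hne hac) (hne hbc) (hne (Ne.symm hb))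
          (hne hbc) h1)
    refine ⟨l, hlmem, ?_⟩
    have hdl : d l = jd := by
      by_contra hcon
      exact hne hcon (crossRatio_injective (hne hab) (hne hac) (hne hbc) (hne (hbd l hlmem))
        (hne (Ne.symm hb)) (hcr l hlmem))
    simp only [hdl]
end

section
/- Let q = p^s with p prime and s > 1, let 0 < i < s with m = gcd(i, s), and suppose p^m ≥ 3. Let h = (q − p^i)/2, or let p be odd and h = (p^i − 1)/2. Then the codewords of minimum weight q − p^m in D_h support a 3-(q+1, q−p^m, λ) design with λ = (q − p^m)(q − p^m − 1)(q − p^m − 2) / ((p^{2m} − 1) p^m): for every 3-element subset T of {0, 1, …, q}, the number of (q − p^m)-element subsets S of {0, 1, …, q} with T ⊆ S such that S is the support of some codeword of D_h equals λ. -/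
/-- Double counting of the pairs (point outside `U`, block containing `U` and that point). -/
theorem sum_card_blocks_insert {α : Type*} [Fintype α] [DecidableEq α] {k : ℕ}
    {𝓑 : Finset (Finset α)} (hk : ∀ B ∈ 𝓑, B.card = k) (U : Finset α) :
    ∑ x ∈ Uᶜ, ((𝓑.filter fun B => insert x U ⊆ B).card : ℤ) =
      ((k : ℤ) - U.card) * (𝓑.filter fun B => U ⊆ B).card := by
  have h1 : ∀ x ∈ Uᶜ, ((𝓑.filter fun B => insert x U ⊆ B).card : ℤ) =
      ∑ B ∈ 𝓑.filter (fun B => U ⊆ B), if x ∈ B then 1 else 0 := by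
    intro x _
    rw [← Finset.sum_filter, Finset.filter_filter, Finset.sum_const, nsmul_one]
    congr 2
    ext B
    simp [Finset.insert_subset_iff, and_comm]
  rw [Finset.sum_congr rfl h1, Finset.sum_comm, mul_comm, ← nsmul_eq_mul, ← Finset.sum_const]
  refine Finset.sum_congr rfl fun B hB => ?_
  rw [Finset.mem_filter] at hB
  rw [← Finset.sum_filter, Finset.sum_const, nsmul_one]
  have : (Uᶜ.filter fun x => x ∈ B) = B \ U := by
    ext x
    simp [and_comm]
  rw [this, Finset.card_sdiff_of_subset hB.2, hk B hB.1,
    Nat.cast_sub (hk B hB.1 ▸ Finset.card_le_card hB.2)]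

/-- In a Steiner system `S(3, k, v)`, the number of blocks disjoint from a given triple. -/
theorem steiner_card_disjoint {α : Type*} [Fintype α] [DecidableEq α] {k : ℕ}
    {𝓑 : Finset (Finset α)} (hk : ∀ B ∈ 𝓑, B.card = k)
    (h3 : ∀ T : Finset α, T.card = 3 → (𝓑.filter fun B => T ⊆ B).card = 1)
    {T : Finset α} (hT : T.card = 3) :
    (k : ℤ) * (k - 1) * (k - 2) * (𝓑.filter fun B => Disjoint T B).card =
      (Fintype.card α - k) * (Fintype.card α - k - 1) * (Fintype.card α - k - 2) := by
  set v : ℤ := (Fintype.card α : ℤ) with hv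
  have hc : ∀ U : Finset α, ((Uᶜ).card : ℤ) = v - U.card := fun U => by
    rw [Finset.card_compl, Nat.cast_sub (Finset.card_le_univ U)]
  set n : Finset α → ℤ := fun U => ((𝓑.filter fun B => U ⊆ B).card : ℤ) with hn
  have hd : ∀ U, ∑ x ∈ Uᶜ, n (insert x U) = ((k : ℤ) - U.card) * n U :=
    sum_card_blocks_insert hk
  have n3 : ∀ U : Finset α, U.card = 3 → n U = 1 := fun U hU => by simp [hn, h3 U hU]
  have n2 : ∀ U : Finset α, U.card = 2 → ((k : ℤ) - 2) * n U = v - 2 := fun U hU => by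
    have := hd U
    rw [hU, Finset.sum_congr rfl (g := fun _ => (1 : ℤ)) fun x hx => n3 _ (by
      rw [Finset.card_insert_of_notMem (Finset.mem_compl.1 hx), hU])] at this
    rw [Finset.sum_const, nsmul_one, hc, hU] at this
    push_cast at this
    exact this.symm
  have n1 : ∀ U : Finset α, U.card = 1 →
      ((k : ℤ) - 2) * (k - 1) * n U = (v - 1) * (v - 2) := fun U hU => by
    have := congrArg (((k : ℤ) - 2) * ·) (hd U)
    simp only [Finset.mul_sum] at this
    rw [hU, Finset.sum_congr rfl (g := fun _ => v - 2) fun x hx => n2 _ (by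
      rw [Finset.card_insert_of_notMem (Finset.mem_compl.1 hx), hU])] at this
    rw [Finset.sum_const, nsmul_eq_mul, hc, hU] at this
    push_cast at this
    linear_combination -this
  have n0 : ((k : ℤ) - 2) * (k - 1) * k * n ∅ = v * (v - 1) * (v - 2) := by
    have := congrArg (((k : ℤ) - 2) * (k - 1) * ·) (hd ∅)
    simp only [Finset.mul_sum] at this
    rw [Finset.sum_congr rfl (g := fun _ => (v - 1) * (v - 2)) fun x hx => n1 _ (by simp)] at this
    rw [Finset.sum_const, nsmul_eq_mul, hc] at this
    push_cast [Finset.card_empty] at this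
    linear_combination -this
  obtain ⟨x, y, z, hxy, hxz, hyz, rfl⟩ := Finset.card_eq_three.1 hT
  have key : ((𝓑.filter fun B => Disjoint {x, y, z} B).card : ℤ) =
      n ∅ - n {x} - n {y} - n {z} + n {x, y} + n {x, z} + n {y, z} - n {x, y, z} := by
    have hs : ∀ P : Finset α → Prop, ∀ [DecidablePred P],
        ((𝓑.filter P).card : ℤ) = ∑ B ∈ 𝓑, if P B then 1 else 0 := fun P _ => by
      rw [← Finset.sum_filter, Finset.sum_const, nsmul_one]
    simp only [hn, hs, ← Finset.sum_add_distrib, ← Finset.sum_sub_distrib]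
    refine Finset.sum_congr rfl fun B _ => ?_
    by_cases hx : x ∈ B <;> by_cases hy : y ∈ B <;> by_cases hz : z ∈ B <;>
      simp [Finset.insert_subset_iff, hx, hy, hz]
  rw [key, n3 _ hT]
  have a1 := n1 {x} (by simp)
  have a2 := n1 {y} (by simp)
  have a3 := n1 {z} (by simp)
  have b1 := n2 {x, y} (Finset.card_pair hxy)
  have b2 := n2 {x, z} (Finset.card_pair hxz)
  have b3 := n2 {y, z} (Finset.card_pair hyz)
  linear_combination n0 - k * (a1 + a2 + a3) + k * (k - 1) * (b1 + b2 + b3)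

theorem cross_ratio_iff {K : Type*} [Field K] {A B C D x₁ x₂ x₃ y₁ y₂ y₃ x y : K}
    (hx₁ : A * x₁ + B ≠ 0) (hx₂ : A * x₂ + B ≠ 0) (hx₃ : A * x₃ + B ≠ 0) (hx : A * x + B ≠ 0)
    (h₁ : y₁ * (A * x₁ + B) + (C * x₁ + D) = 0) (h₂ : y₂ * (A * x₂ + B) + (C * x₂ + D) = 0)
    (h₃ : y₃ * (A * x₃ + B) + (C * x₃ + D) = 0)
    (x12 : x₁ ≠ x₂) (y13 : y₁ ≠ y₃) (y23 : y₂ ≠ y₃) (hx3 : x ≠ x₃) :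
    y * (A * x + B) + (C * x + D) = 0 ↔
      (y - y₁) * (y₂ - y₃) * ((x - x₃) * (x₂ - x₁)) =
        (x - x₁) * (x₂ - x₃) * ((y - y₃) * (y₂ - y₁)) := by
  obtain ⟨w, hw⟩ : ∃ w, w * (A * x + B) + (C * x + D) = 0 :=
    ⟨-(C * x + D) / (A * x + B), by rw [div_mul_cancel₀ _ hx]; ring⟩
  have hdiff : ∀ {u v s t : K}, A * s + B ≠ 0 → A * t + B ≠ 0 →
      u * (A * s + B) + (C * s + D) = 0 → v * (A * t + B) + (C * t + D) = 0 →
      u - v = (A * D - B * C) * (s - t) / ((A * s + B) * (A * t + B)) := by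
    intro u v s t hs ht hu hv
    field_simp
    linear_combination (A * t + B) * hu - (A * s + B) * hv
  have hcross : (w - y₁) * (y₂ - y₃) * ((x - x₃) * (x₂ - x₁)) =
        (x - x₁) * (x₂ - x₃) * ((w - y₃) * (y₂ - y₁)) := by
    rw [hdiff hx hx₁ hw h₁, hdiff hx₂ hx₃ h₂ h₃, hdiff hx hx₃ hw h₃, hdiff hx₂ hx₁ h₂ h₁]
    generalize A * x + B = e, A * x₁ + B = e₁, A * x₂ + B = e₂, A * x₃ + B = e₃
    ring
  have hyw : y * (A * x + B) + (C * x + D) = 0 ↔ y = w := by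
    constructor
    · intro hy
      exact mul_right_cancel₀ hx (by linear_combination hy - hw)
    · rintro rfl
      exact hw
  rw [hyw]
  constructor
  · rintro rfl
    exact hcross
  · intro hy
    by_contra hne
    have hL : (y₂ - y₃) * ((x - x₃) * (x₂ - x₁)) - (x - x₁) * (x₂ - x₃) * (y₂ - y₁) = 0 :=
      mul_left_cancel₀ (sub_ne_zero.2 hne) (by linear_combination hy - hcross)
    have h1 : (y₁ - y₃) * (y₂ - y₃) * ((x - x₃) * (x₂ - x₁)) = 0 := by
      linear_combination (y - y₃) * hL - hy
    simp [sub_eq_zero, y13, y23, hx3, x12.symm] at h1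

theorem conj_sub {K : Type*} [Field K] {p s : ℕ} [CharP K p] [Fact p.Prime] {x y : K}
    (hx : x ^ (p ^ s + 1) = 1) (hy : y ^ (p ^ s + 1) = 1) :
    (x - y) ^ p ^ s = -(x - y) / (x * y) := by
  have hx0 : x ≠ 0 := by rintro rfl; simp at hx
  have hy0 : y ≠ 0 := by rintro rfl; simp at hy
  rw [pow_succ] at hx hy
  rw [sub_pow_char_pow, eq_inv_of_mul_eq_one_left hx, eq_inv_of_mul_eq_one_left hy]
  field_simp
  ring

theorem card_fixed_pow {K : Type*} [Field K] [Fintype K] [DecidableEq K] {p s i : ℕ} (hp : p.Prime)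
    [CharP K p] (hi : 0 < i) (hK : Fintype.card K = (p ^ s) ^ 2) :
    (Finset.univ.filter fun t : K => t ^ p ^ i = t ∧ t ^ p ^ s = t).card = p ^ Nat.gcd i s := by
  have : Fact p.Prime := ⟨hp⟩
  set m := Nat.gcd i s with hm
  have hm0 : m ≠ 0 := (Nat.gcd_pos_of_pos_left s hi).ne'
  have hM : 1 < p ^ m := Nat.one_lt_pow hm0 hp.one_lt
  have hper : ∀ (n : ℕ) (t : K), t ^ p ^ n = t ↔ Function.IsPeriodicPt (frobenius K p) n t := by
    intro n t
    rw [Function.IsPeriodicPt, Function.IsFixedPt, iterate_frobenius]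
  have hfix : ∀ t : K, (t ^ p ^ i = t ∧ t ^ p ^ s = t) ↔ t ^ p ^ m = t := by
    intro t
    simp only [hper]
    exact ⟨fun h => h.1.gcd h.2, fun h => ⟨h.trans_dvd (Nat.gcd_dvd_left _ _),
      h.trans_dvd (Nat.gcd_dvd_right _ _)⟩⟩
  simp only [hfix]
  obtain ⟨g, hg⟩ := IsCyclic.exists_ofOrder_eq_natCard (α := Kˣ)
  have hcard : Nat.card Kˣ = p ^ (s * 2) - 1 := by
    rw [Nat.card_eq_fintype_card, Fintype.card_units, hK, pow_mul]
  obtain ⟨e, he⟩ : p ^ m - 1 ∣ p ^ (s * 2) - 1 :=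
    Nat.pow_sub_one_dvd_pow_sub_one p ((Nat.gcd_dvd_right i s).mul_right 2)
  have hgp : IsPrimitiveRoot (g : K) (p ^ (s * 2) - 1) := by
    rw [IsPrimitiveRoot.coe_units_iff, ← hcard, ← hg]
    exact IsPrimitiveRoot.orderOf g
  have hpos : 0 < p ^ (s * 2) - 1 := hcard ▸ Nat.card_pos
  have hζ : IsPrimitiveRoot ((g : K) ^ e) (p ^ m - 1) := hgp.pow hpos (by rw [he, mul_comm])
  have heq : (Finset.univ.filter fun t : K => t ^ p ^ m = t) =
      insert 0 (Polynomial.nthRootsFinset (p ^ m - 1) (1 : K)) := by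
    ext t
    rw [Finset.mem_filter, Finset.mem_insert, Polynomial.mem_nthRootsFinset (by omega)]
    by_cases ht : t = 0
    · simp [ht, hp.ne_zero]
    · obtain ⟨M, hM'⟩ : ∃ M, p ^ m = M + 1 := ⟨p ^ m - 1, by omega⟩
      simp [ht, hM', pow_succ]
  rw [heq, Finset.card_insert_of_notMem, hζ.card_nthRootsFinset]
  · omega
  · rw [Polynomial.mem_nthRootsFinset (by omega), zero_pow (by omega)]
    exact zero_ne_one

section Norm

variable {K : Type*} [Field K] {p s i : ℕ} [CharP K p] [Fact p.Prime] {A B x₁ x₂ x₃ : K}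

theorem pow_char_pow_injective (i : ℕ) : Function.Injective fun x : K => x ^ p ^ i := by
  have h := (iterateFrobenius K p i).injective
  simpa only [coe_iterateFrobenius, iterate_frobenius, Function.Injective] using h

/-- The line `A x + B` of a nonzero self-conjugate trinomial with three zeros on the unit circle
has no zero there. -/
theorem linear_ne_zero_of_three_zeros (hAB : ¬(A = 0 ∧ B = 0))
    (h₁ : x₁ ^ p ^ i * (A * x₁ + B) + (B ^ p ^ s * x₁ + A ^ p ^ s) = 0)
    (h₂ : x₂ ^ p ^ i * (A * x₂ + B) + (B ^ p ^ s * x₂ + A ^ p ^ s) = 0)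
    (h₃ : x₃ ^ p ^ i * (A * x₃ + B) + (B ^ p ^ s * x₃ + A ^ p ^ s) = 0)
    (h12 : x₁ ≠ x₂) (h13 : x₁ ≠ x₃) (h23 : x₂ ≠ x₃) {x : K} (hx : x ^ (p ^ s + 1) = 1) :
    A * x + B ≠ 0 := by
  intro h0
  have hx0 : x ≠ 0 := by rintro rfl; simp at hx
  have hB : B = -(A * x) := by linear_combination h0
  have hA : A ≠ 0 := by
    rintro rfl
    exact hAB ⟨rfl, by simpa using hB⟩
  have hconj : A ^ p ^ s = -(B ^ p ^ s * x) := by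
    have h := congrArg (· ^ p ^ s) h0
    simp only [add_pow_char_pow, mul_pow, zero_pow (pow_ne_zero s (Fact.out : p.Prime).ne_zero)] at h
    linear_combination x * h - A ^ p ^ s * hx
  have hz : ∀ y : K, y ^ p ^ i * (A * y + B) + (B ^ p ^ s * y + A ^ p ^ s) = 0 →
      y = x ∨ y ^ p ^ i = -B ^ p ^ s / A := by
    intro y hy
    have : (y - x) * (A * y ^ p ^ i + B ^ p ^ s) = 0 := by
      rw [hconj] at hy
      linear_combination hy - y ^ p ^ i * hB
    rcases mul_eq_zero.1 this with h | h
    · exact Or.inl (sub_eq_zero.1 h)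
    · right
      rw [eq_div_iff hA]
      linear_combination h
  have hinj := pow_char_pow_injective (K := K) (p := p) i
  have hne : ∀ {y z : K}, y ≠ z → y ^ p ^ i = -B ^ p ^ s / A → z ^ p ^ i ≠ -B ^ p ^ s / A :=
    fun hyz hy hz' => hyz (hinj (hy.trans hz'.symm))
  rcases hz _ h₁ with e₁ | e₁ <;> rcases hz _ h₂ with e₂ | e₂ <;> rcases hz _ h₃ with e₃ | e₃
  · exact h12 (e₁.trans e₂.symm)
  · exact h12 (e₁.trans e₂.symm)
  · exact h13 (e₁.trans e₃.symm)
  · exact hne h23 e₂ e₃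
  · exact h23 (e₂.trans e₃.symm)
  · exact hne h13 e₁ e₃
  · exact hne h12 e₁ e₂
  · exact hne h12 e₁ e₂

/-- The zeros on the unit circle are the points whose cross-ratio with three given zeros is fixed
by the Frobenius power. -/
theorem trinomial_zero_iff (hAB : ¬(A = 0 ∧ B = 0))
    (hx₁ : x₁ ^ (p ^ s + 1) = 1) (hx₂ : x₂ ^ (p ^ s + 1) = 1) (hx₃ : x₃ ^ (p ^ s + 1) = 1)
    (h₁ : x₁ ^ p ^ i * (A * x₁ + B) + (B ^ p ^ s * x₁ + A ^ p ^ s) = 0)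
    (h₂ : x₂ ^ p ^ i * (A * x₂ + B) + (B ^ p ^ s * x₂ + A ^ p ^ s) = 0)
    (h₃ : x₃ ^ p ^ i * (A * x₃ + B) + (B ^ p ^ s * x₃ + A ^ p ^ s) = 0)
    (h12 : x₁ ≠ x₂) (h13 : x₁ ≠ x₃) (h23 : x₂ ≠ x₃) {x : K} (hx : x ^ (p ^ s + 1) = 1)
    (hxx₃ : x ≠ x₃) :
    x ^ p ^ i * (A * x + B) + (B ^ p ^ s * x + A ^ p ^ s) = 0 ↔
      ((x - x₁) * (x₂ - x₃) / ((x - x₃) * (x₂ - x₁))) ^ p ^ i =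
        (x - x₁) * (x₂ - x₃) / ((x - x₃) * (x₂ - x₁)) := by
  have hE : ∀ {y : K}, y ^ (p ^ s + 1) = 1 → A * y + B ≠ 0 := fun hy =>
    linear_ne_zero_of_three_zeros hAB h₁ h₂ h₃ h12 h13 h23 hy
  have hinj := pow_char_pow_injective (K := K) (p := p) i
  rw [cross_ratio_iff (hE hx₁) (hE hx₂) (hE hx₃) (hE hx) h₁ h₂ h₃ h12 (hinj.ne h13) (hinj.ne h23) hxx₃,
    div_pow, mul_pow, mul_pow, div_eq_div_iff]
  · simp only [sub_pow_char_pow]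
  · exact mul_ne_zero (pow_ne_zero _ (sub_ne_zero.2 hxx₃)) (pow_ne_zero _ (sub_ne_zero.2 h12.symm))
  · exact mul_ne_zero (sub_ne_zero.2 hxx₃) (sub_ne_zero.2 h12.symm)

theorem cross_ratio_conj (hx₁ : x₁ ^ (p ^ s + 1) = 1) (hx₂ : x₂ ^ (p ^ s + 1) = 1)
    (hx₃ : x₃ ^ (p ^ s + 1) = 1) (h12 : x₁ ≠ x₂) {x : K} (hx : x ^ (p ^ s + 1) = 1)
    (hxx₃ : x ≠ x₃) :
    ((x - x₁) * (x₂ - x₃) / ((x - x₃) * (x₂ - x₁))) ^ p ^ s =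
      (x - x₁) * (x₂ - x₃) / ((x - x₃) * (x₂ - x₁)) := by
  have hz : ∀ {y : K}, y ^ (p ^ s + 1) = 1 → y ≠ 0 := by
    rintro y hy rfl
    simp at hy
  have := hz hx
  have := hz hx₁
  have := hz hx₂
  have := hz hx₃
  have := sub_ne_zero.2 hxx₃
  have := sub_ne_zero.2 h12.symm
  rw [div_pow, mul_pow, mul_pow, conj_sub hx hx₁, conj_sub hx₂ hx₃, conj_sub hx hx₃,
    conj_sub hx₂ hx₁]
  field_simp

/-- A point of the unit circle with prescribed cross-ratio. -/
theorem cross_ratio_inv (hx₁ : x₁ ^ (p ^ s + 1) = 1) (hx₂ : x₂ ^ (p ^ s + 1) = 1)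
    (hx₃ : x₃ ^ (p ^ s + 1) = 1) (h12 : x₁ ≠ x₂) (h13 : x₁ ≠ x₃) (h23 : x₂ ≠ x₃) {t : K}
    (ht : t ^ p ^ s = t) :
    ∃ x, x ^ (p ^ s + 1) = 1 ∧ x ≠ x₃ ∧
      (x - x₁) * (x₂ - x₃) / ((x - x₃) * (x₂ - x₁)) = t := by
  have hz : ∀ {y : K}, y ^ (p ^ s + 1) = 1 → y ≠ 0 := by
    rintro y hy rfl
    simp at hy
  have z₁ := hz hx₁
  have z₂ := hz hx₂
  have z₃ := hz hx₃
  have hx₁' : x₁ ^ p ^ s = x₁⁻¹ := eq_inv_of_mul_eq_one_left (by rw [← pow_succ, hx₁])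
  have hx₃' : x₃ ^ p ^ s = x₃⁻¹ := eq_inv_of_mul_eq_one_left (by rw [← pow_succ, hx₃])
  have s21 := sub_ne_zero.2 h12.symm
  have s23 := sub_ne_zero.2 h23
  have s13 := sub_ne_zero.2 h13
  set d := (x₂ - x₃) - t * (x₂ - x₁) with hd
  set n := x₁ * (x₂ - x₃) - t * x₃ * (x₂ - x₁) with hn
  have hdc : d ^ p ^ s = -n / (x₁ * x₂ * x₃) := by
    rw [hd, sub_pow_char_pow, mul_pow, conj_sub hx₂ hx₃, conj_sub hx₂ hx₁, ht, hn]
    field_simp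
    ring
  have hnc : n ^ p ^ s = -d / (x₁ * x₂ * x₃) := by
    rw [hn, sub_pow_char_pow, mul_pow, mul_pow, mul_pow, conj_sub hx₂ hx₃, conj_sub hx₂ hx₁, ht,
      hx₁', hx₃', hd]
    field_simp
    ring
  have hp0 : p ^ s ≠ 0 := pow_ne_zero s (Fact.out : p.Prime).ne_zero
  have hd0 : d ≠ 0 := by
    intro h
    have hn0 : n = 0 := by
      rw [h, zero_pow hp0] at hdc
      simpa [z₁, z₂, z₃, eq_comm] using hdc
    exact mul_ne_zero s13 s23 (by linear_combination hn0 - x₃ * h - hn + x₃ * hd)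
  have hn0 : n ≠ 0 := by
    intro h
    rw [h, zero_pow hp0] at hnc
    exact hd0 (by simpa [z₁, z₂, z₃, eq_comm] using hnc)
  have e₁ : n / d - x₁ = t * (x₂ - x₁) * (x₁ - x₃) / d := by
    field_simp
    rw [hn, hd]
    ring
  have e₃ : n / d - x₃ = (x₂ - x₃) * (x₁ - x₃) / d := by
    field_simp
    rw [hn, hd]
    ring
  refine ⟨n / d, ?_, ?_, ?_⟩
  · rw [pow_succ, div_pow, hnc, hdc]
    field_simp
  · rw [← sub_ne_zero, e₃]
    exact div_ne_zero (mul_ne_zero s23 s13) hd0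
  · rw [e₁, e₃]
    field_simp

theorem cross_ratio_injective (h12 : x₁ ≠ x₂) (h13 : x₁ ≠ x₃) (h23 : x₂ ≠ x₃) {x y : K}
    (hx : x ≠ x₃) (hy : y ≠ x₃)
    (h : (x - x₁) * (x₂ - x₃) / ((x - x₃) * (x₂ - x₁)) =
      (y - x₁) * (x₂ - x₃) / ((y - x₃) * (x₂ - x₁))) : x = y := by
  have s21 := sub_ne_zero.2 h12.symm
  have s23 := sub_ne_zero.2 h23
  have s13 := sub_ne_zero.2 h13
  rw [div_eq_div_iff (mul_ne_zero (sub_ne_zero.2 hx) s21) (mul_ne_zero (sub_ne_zero.2 hy) s21)] at h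
  refine mul_left_cancel₀ (mul_ne_zero (mul_ne_zero s21 s23) s13) ?_
  linear_combination h

theorem card_trinomial_zeros [Fintype K] [DecidableEq K] (hi : 0 < i)
    (hK : Fintype.card K = (p ^ s) ^ 2) (hAB : ¬(A = 0 ∧ B = 0))
    (hx₁ : x₁ ^ (p ^ s + 1) = 1) (hx₂ : x₂ ^ (p ^ s + 1) = 1) (hx₃ : x₃ ^ (p ^ s + 1) = 1)
    (h₁ : x₁ ^ p ^ i * (A * x₁ + B) + (B ^ p ^ s * x₁ + A ^ p ^ s) = 0)
    (h₂ : x₂ ^ p ^ i * (A * x₂ + B) + (B ^ p ^ s * x₂ + A ^ p ^ s) = 0)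
    (h₃ : x₃ ^ p ^ i * (A * x₃ + B) + (B ^ p ^ s * x₃ + A ^ p ^ s) = 0)
    (h12 : x₁ ≠ x₂) (h13 : x₁ ≠ x₃) (h23 : x₂ ≠ x₃) :
    (Finset.univ.filter fun x : K => x ^ (p ^ s + 1) = 1 ∧
      x ^ p ^ i * (A * x + B) + (B ^ p ^ s * x + A ^ p ^ s) = 0).card = p ^ Nat.gcd i s + 1 := by
  set Z := Finset.univ.filter fun x : K => x ^ (p ^ s + 1) = 1 ∧
      x ^ p ^ i * (A * x + B) + (B ^ p ^ s * x + A ^ p ^ s) = 0 with hZ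
  have hmem : ∀ x, x ∈ Z ↔ x ^ (p ^ s + 1) = 1 ∧
      x ^ p ^ i * (A * x + B) + (B ^ p ^ s * x + A ^ p ^ s) = 0 := fun x => by simp [hZ]
  have hiff := @trinomial_zero_iff K _ p s i _ _ A B x₁ x₂ x₃ hAB hx₁ hx₂ hx₃ h₁ h₂ h₃ h12 h13 h23
  rw [← Finset.card_erase_add_one ((hmem x₃).2 ⟨hx₃, h₃⟩), ← card_fixed_pow Fact.out hi hK]
  congr 1
  refine Finset.card_bij (fun x _ => (x - x₁) * (x₂ - x₃) / ((x - x₃) * (x₂ - x₁))) ?_ ?_ ?_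
  · intro x hx
    rw [Finset.mem_erase, hmem] at hx
    simp only [Finset.mem_filter, Finset.mem_univ, true_and]
    exact ⟨(hiff hx.2.1 hx.1).1 hx.2.2, cross_ratio_conj hx₁ hx₂ hx₃ h12 hx.2.1 hx.1⟩
  · intro x hx y hy h
    exact cross_ratio_injective h12 h13 h23 (Finset.ne_of_mem_erase hx)
      (Finset.ne_of_mem_erase hy) h
  · intro t ht
    simp only [Finset.mem_filter, Finset.mem_univ, true_and] at ht
    obtain ⟨x, hx, hx3, rfl⟩ := cross_ratio_inv hx₁ hx₂ hx₃ h12 h13 h23 ht.2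
    exact ⟨x, Finset.mem_erase.2 ⟨hx3, (hmem x).2 ⟨hx, (hiff hx hx3).2 ht.1⟩⟩, rfl⟩

end Norm

/-- The coordinates of the code vanish at the unit circle zeros of self-conjugate trinomials. -/
theorem exists_trinomial_of_trace {p s i h : ℕ} [Fact p.Prime] (hi : i < s)
    (hh : 2 * h = p ^ s - p ^ i ∨ (Odd p ∧ 2 * h = p ^ i - 1))
    {F K : Type*} [Field F] [Field K] [Fintype F] [Fintype K] [Algebra F K] [CharP K p]
    (hF : Fintype.card F = p ^ s) (hK : Fintype.card K = (p ^ s) ^ 2) (a b : K) :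
    ∃ A B : K, ((A = 0 ∧ B = 0) ↔ (a = 0 ∧ b = 0)) ∧ ∀ x : K, x ^ (p ^ s + 1) = 1 →
      (Algebra.trace F K (a * x ^ h + b * x ^ (h + 1)) = 0 ↔
        x ^ p ^ i * (A * x + B) + (B ^ p ^ s * x + A ^ p ^ s) = 0) := by
  have hp : p.Prime := Fact.out
  have hrank : Module.finrank F K = 2 := by
    have := Module.card_eq_pow_finrank (K := F) (V := K)
    rw [hF, hK] at this
    exact (Nat.pow_right_injective (Nat.one_lt_pow (by omega) hp.one_lt) this).symm
  have htr : ∀ x : K, x ^ (p ^ s + 1) = 1 →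
      (Algebra.trace F K (a * x ^ h + b * x ^ (h + 1)) = 0 ↔
        a * x ^ (2 * h + 1) + b * x ^ (2 * h + 2) + a ^ p ^ s * x + b ^ p ^ s = 0) := by
    intro x hx
    have hx0 : x ≠ 0 := by rintro rfl; simp at hx
    rw [← map_eq_zero_iff (algebraMap F K) (FaithfulSMul.algebraMap_injective F K),
      FiniteField.algebraMap_trace_eq_sum_pow, hrank, Nat.card_eq_fintype_card, hF,
      Finset.sum_range_succ, Finset.sum_range_one, pow_zero, pow_one, pow_one,
      ← mul_eq_zero_iff_left (pow_ne_zero (h + 1) hx0), add_pow_char_pow, mul_pow, mul_pow]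
    have e : (x ^ p ^ s * x) ^ h = 1 := by rw [← pow_succ, hx, one_pow]
    have e' : (x ^ p ^ s * x) ^ (h + 1) = 1 := by rw [← pow_succ, hx, one_pow]
    rw [mul_pow] at e e'
    have : x ^ (h + 1) * (a * x ^ h + b * x ^ (h + 1) +
        (a ^ p ^ s * (x ^ h) ^ p ^ s + b ^ p ^ s * (x ^ (h + 1)) ^ p ^ s)) =
        a * x ^ (2 * h + 1) + b * x ^ (2 * h + 2) + a ^ p ^ s * x + b ^ p ^ s := by
      rw [pow_right_comm x h, pow_right_comm x (h + 1)]
      linear_combination a ^ p ^ s * x * e + b ^ p ^ s * e'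
    rw [this]
  have hle : p ^ i < p ^ s := Nat.pow_lt_pow_right hp.one_lt hi
  have hP : 0 < p ^ i := pow_pos hp.pos i
  have hinv : ∀ c : K, (c ^ p ^ s) ^ p ^ s = c := fun c => by
    rw [← pow_mul, ← sq, ← hK, FiniteField.pow_card]
  rcases hh with hh | ⟨-, hh⟩
  · refine ⟨a ^ p ^ s, b ^ p ^ s, by simp [hp.ne_zero], fun x hx => ?_⟩
    have hx0 : x ≠ 0 := by rintro rfl; simp at hx
    rw [htr x hx, ← mul_eq_zero_iff_left (pow_ne_zero (p ^ i) hx0), hinv, hinv]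
    have e : x ^ p ^ i * x ^ (2 * h + 1) = 1 := by
      rw [← pow_add, ← hx]
      congr 1
      omega
    have : x ^ p ^ i * (a * x ^ (2 * h + 1) + b * x ^ (2 * h + 2) + a ^ p ^ s * x + b ^ p ^ s) =
        x ^ p ^ i * (a ^ p ^ s * x + b ^ p ^ s) + (b * x + a) := by
      linear_combination (a + b * x) * e
    rw [this]
  · refine ⟨b, a, and_comm, fun x hx => ?_⟩
    rw [htr x hx]
    have e : p ^ i = 2 * h + 1 := by omega
    rw [e]
    ring_nf

theorem exists_ne_zero_codeword {F K : Type*} [Field F] [Field K] [Fintype F] [Fintype K]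
    [Algebra F K] {q : ℕ} (hF : Fintype.card F = q) (hK : Fintype.card K = q ^ 2)
    (u v : Fin 3 → K) :
    ∃ a b : K, ¬(a = 0 ∧ b = 0) ∧ ∀ k, Algebra.trace F K (a * u k + b * v k) = 0 := by
  have hq : 1 < q := hF ▸ Fintype.one_lt_card
  obtain ⟨⟨a, b⟩, ⟨a', b'⟩, hne, heq⟩ := Fintype.exists_ne_map_eq_of_card_lt
    (fun (c : K × K) (k : Fin 3) => Algebra.trace F K (c.1 * u k + c.2 * v k)) (by
      rw [Fintype.card_prod, Fintype.card_fun, Fintype.card_fin, hF, hK, ← pow_add]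
      exact Nat.pow_lt_pow_right hq (by norm_num))
  refine ⟨a - a', b - b', fun h => hne ?_, fun k => ?_⟩
  · rw [sub_eq_zero.1 h.1, sub_eq_zero.1 h.2]
  · have := congrFun heq k
    rw [← sub_eq_zero, ← map_sub] at this
    rw [← this]
    congr 1
    ring

theorem stmt11 (p s : ℕ) (hp : p.Prime) (hs : 1 < s) (q : ℕ) (hq : q = p ^ s)
    (i m : ℕ) (hi0 : 0 < i) (his : i < s) (hm : m = Nat.gcd i s) (hpm : 3 ≤ p ^ m)
    (h : ℕ) (hh : 2 * h = q - p ^ i ∨ (Odd p ∧ 2 * h = p ^ i - 1))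
    (F K : Type) [Field F] [Field K] [Fintype F] [Fintype K] [DecidableEq F]
    [Algebra F K] (hF : Fintype.card F = q) (hK : Fintype.card K = q ^ 2)
    (β : K) (hβ : IsPrimitiveRoot β (q + 1))
    (D : Set (Fin (q + 1) → F))
    (hD : D = {c | ∃ a b : K, ∀ j : Fin (q + 1),
      c j = Algebra.trace F K (a * β ^ (h * (j : ℕ)) + b * β ^ ((h + 1) * (j : ℕ)))}) :
    ∀ T : Finset (Fin (q + 1)), T.card = 3 →
      ((p ^ (2 * m) - 1) * p ^ m) *
        {S : Finset (Fin (q + 1)) | S.card = q - p ^ m ∧ T ⊆ S ∧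
          ∃ c ∈ D, (Finset.univ.filter fun j => c j ≠ 0) = S}.ncard =
      (q - p ^ m) * (q - p ^ m - 1) * (q - p ^ m - 2) := by
  classical
  have : Fact p.Prime := ⟨hp⟩
  have : CharP K p := charP_of_card_eq_prime_pow (f := s * 2) (by rw [hK, hq, pow_mul])
  have hms : m < s := (hm ▸ Nat.gcd_le_left s hi0).trans_lt his
  have hMq : p ^ m * 3 ≤ q := by
    rw [hq, ← Nat.sub_add_cancel hms.le, pow_add, mul_comm]
    refine Nat.mul_le_mul_right _ (hpm.trans (Nat.pow_le_pow_right hp.pos ?_))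
    exact Nat.le_of_dvd (by omega) (Nat.dvd_sub (hm ▸ Nat.gcd_dvd_right i s) dvd_rfl)
  set Z : K → K → Finset (Fin (q + 1)) := fun a b => Finset.univ.filter fun j =>
    Algebra.trace F K (a * (β ^ (j : ℕ)) ^ h + b * (β ^ (j : ℕ)) ^ (h + 1)) = 0 with hZ
  have hmemZ : ∀ {a b j}, j ∈ Z a b ↔
      Algebra.trace F K (a * (β ^ (j : ℕ)) ^ h + b * (β ^ (j : ℕ)) ^ (h + 1)) = 0 := by
    intro a b j
    simp [hZ]
  set 𝓑 : Finset (Finset (Fin (q + 1))) := Finset.univ.filter fun B =>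
    B.card = p ^ m + 1 ∧ ∃ a b, Z a b = B with hB
  have hinj : Function.Injective fun j : Fin (q + 1) => β ^ (j : ℕ) := fun j k hjk =>
    Fin.ext (hβ.pow_inj j.2 k.2 hjk)
  have hU : ∀ j : Fin (q + 1), (β ^ (j : ℕ)) ^ (p ^ s + 1) = 1 := fun j => by
    rw [← hq, pow_right_comm, hβ.pow_eq_one, one_pow]
  have htri := exists_trinomial_of_trace (h := h) his (hq ▸ hh) (hF.trans hq) (hq ▸ hK)
  have hcard : ∀ {a b : K} {j₁ j₂ j₃ : Fin (q + 1)}, ¬(a = 0 ∧ b = 0) → j₁ ≠ j₂ → j₁ ≠ j₃ →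
      j₂ ≠ j₃ → j₁ ∈ Z a b → j₂ ∈ Z a b → j₃ ∈ Z a b → (Z a b).card = p ^ m + 1 := by
    intro a b j₁ j₂ j₃ hab h12 h13 h23 m₁ m₂ m₃
    obtain ⟨A, B, hAB, hiff⟩ := htri a b
    rw [hmemZ, hiff _ (hU _)] at m₁ m₂ m₃
    rw [hm, ← card_trinomial_zeros hi0 (hq ▸ hK) (hAB.not.2 hab) (hU j₁) (hU j₂) (hU j₃) m₁ m₂ m₃
      (hinj.ne h12) (hinj.ne h13) (hinj.ne h23)]
    refine Finset.card_bij (fun j _ => β ^ (j : ℕ)) (fun j hj => ?_)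
      (fun j _ k _ hjk => hinj hjk) (fun x hx => ?_)
    · rw [hmemZ, hiff _ (hU _)] at hj
      simpa using ⟨hU j, hj⟩
    · simp only [Finset.mem_filter, Finset.mem_univ, true_and] at hx
      obtain ⟨j, hj, rfl⟩ := hβ.eq_pow_of_pow_eq_one (hq ▸ hx.1)
      exact ⟨⟨j, hj⟩, hmemZ.2 ((hiff _ hx.1).2 hx.2), rfl⟩
  have huniq : ∀ {a b a' b' : K} {j₁ j₂ j₃ : Fin (q + 1)}, ¬(a = 0 ∧ b = 0) →
      ¬(a' = 0 ∧ b' = 0) → j₁ ≠ j₂ → j₁ ≠ j₃ → j₂ ≠ j₃ →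
      j₁ ∈ Z a b → j₂ ∈ Z a b → j₃ ∈ Z a b → j₁ ∈ Z a' b' → j₂ ∈ Z a' b' → j₃ ∈ Z a' b' →
      Z a b = Z a' b' := by
    intro a b a' b' j₁ j₂ j₃ hab hab' h12 h13 h23 m₁ m₂ m₃ n₁ n₂ n₃
    ext j
    rcases eq_or_ne j j₃ with rfl | hj
    · simp [m₃, n₃]
    obtain ⟨A, B, hAB, hiff⟩ := htri a b
    obtain ⟨A', B', hAB', hiff'⟩ := htri a' b'
    rw [hmemZ, hiff _ (hU _)] at m₁ m₂ m₃ ⊢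
    rw [hmemZ, hiff' _ (hU _)] at n₁ n₂ n₃ ⊢
    rw [trinomial_zero_iff (hAB.not.2 hab) (hU j₁) (hU j₂) (hU j₃) m₁ m₂ m₃ (hinj.ne h12)
      (hinj.ne h13) (hinj.ne h23) (hU j) (hinj.ne hj),
      trinomial_zero_iff (hAB'.not.2 hab') (hU j₁) (hU j₂) (hU j₃) n₁ n₂ n₃ (hinj.ne h12)
      (hinj.ne h13) (hinj.ne h23) (hU j) (hinj.ne hj)]
  have hne : ∀ {a b : K}, (Z a b).card = p ^ m + 1 → ¬(a = 0 ∧ b = 0) := by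
    rintro a b hc ⟨rfl, rfl⟩
    simp [hZ] at hc
    omega
  have hk : ∀ B ∈ 𝓑, B.card = p ^ m + 1 := fun B hB' => (Finset.mem_filter.1 hB').2.1
  have h3 : ∀ T : Finset (Fin (q + 1)), T.card = 3 →
      (𝓑.filter fun B => T ⊆ B).card = 1 := by
    intro T hT
    obtain ⟨j₁, j₂, j₃, h12, h13, h23, rfl⟩ := Finset.card_eq_three.1 hT
    obtain ⟨a, b, hab, h0⟩ := exists_ne_zero_codeword hF hK
      (fun k => (β ^ ((![j₁, j₂, j₃] k : Fin (q + 1)) : ℕ)) ^ h)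
      (fun k => (β ^ ((![j₁, j₂, j₃] k : Fin (q + 1)) : ℕ)) ^ (h + 1))
    have m₁ : j₁ ∈ Z a b := hmemZ.2 (h0 0)
    have m₂ : j₂ ∈ Z a b := hmemZ.2 (h0 1)
    have m₃ : j₃ ∈ Z a b := hmemZ.2 (h0 2)
    refine Finset.card_eq_one.2 ⟨Z a b, Finset.ext fun B => ?_⟩
    simp only [hB, Finset.mem_filter, Finset.mem_univ, true_and, Finset.mem_singleton,
      Finset.insert_subset_iff, Finset.singleton_subset_iff]
    constructor
    · rintro ⟨⟨hc, a', b', rfl⟩, n₁, n₂, n₃⟩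
      exact huniq (hne hc) hab h12 h13 h23 n₁ n₂ n₃ m₁ m₂ m₃
    · rintro rfl
      exact ⟨⟨hcard hab h12 h13 h23 m₁ m₂ m₃, a, b, rfl⟩, m₁, m₂, m₃⟩
  intro T hT
  have hset : {S : Finset (Fin (q + 1)) | S.card = q - p ^ m ∧ T ⊆ S ∧
      ∃ c ∈ D, (Finset.univ.filter fun j => c j ≠ 0) = S} =
      compl '' ((𝓑.filter fun B => Disjoint T B : Finset _) : Set (Finset (Fin (q + 1)))) := by
    ext S
    rw [Set.mem_compl_image]
    have hcompl : Sᶜ.card = p ^ m + 1 ↔ S.card = q - p ^ m := by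
      have := S.card_add_card_compl
      rw [Fintype.card_fin] at this
      omega
    have hcode : (∃ c ∈ D, (Finset.univ.filter fun j => c j ≠ 0) = S) ↔ ∃ a b, Z a b = Sᶜ := by
      have hsupp : ∀ a b, (Finset.univ.filter fun j : Fin (q + 1) => Algebra.trace F K
          (a * β ^ (h * (j : ℕ)) + b * β ^ ((h + 1) * (j : ℕ))) ≠ 0) = (Z a b)ᶜ := by
        intro a b
        ext j
        rw [Finset.mem_compl, hmemZ, ← pow_mul', ← pow_mul']
        simp
      constructor
      · rintro ⟨c, hc, rfl⟩
        rw [hD] at hc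
        obtain ⟨a, b, hc⟩ := hc
        exact ⟨a, b, by simp only [hc, hsupp, compl_compl]⟩
      · rintro ⟨a, b, hab⟩
        refine ⟨fun j => Algebra.trace F K
          (a * β ^ (h * (j : ℕ)) + b * β ^ ((h + 1) * (j : ℕ))), ?_, ?_⟩
        · rw [hD]
          exact ⟨a, b, fun j => rfl⟩
        · rw [hsupp, hab, compl_compl]
    have hdisj : Disjoint T Sᶜ ↔ T ⊆ S := disjoint_compl_right_iff
    simp only [Set.mem_ofPred_eq, hB, Finset.coe_filter, Finset.mem_filter, Finset.mem_univ,
      true_and, hcompl, hcode, hdisj]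
    tauto
  rw [hset, Set.ncard_image_of_injective _ compl_injective, Set.ncard_coe_finset]
  have hfin := steiner_card_disjoint hk h3 hT
  rw [Fintype.card_fin] at hfin
  have hpow : p ^ (2 * m) = p ^ m * p ^ m := by rw [two_mul, pow_add]
  have h1 : 1 ≤ p ^ m * p ^ m := Nat.mul_pos (by omega) (by omega)
  zify [h1, hpow, show p ^ m ≤ q by omega, show 1 ≤ q - p ^ m by omega,
    show 2 ≤ q - p ^ m by omega]
  push_cast at hfin
  linear_combination hfin
end

section
/- Let q = p^s with p prime and s > 1, let 0 < i < s with m = gcd(i, s), and suppose p^m ≥ 3. Let h = (q − p^i)/2, or let p be odd and h = (p^i − 1)/2. Then the weight distribution of D_h is as follows: the number of codewords of Hamming weight q − p^m is (q−1)^2 q (q+1) / ((p^{2m} − 1) p^m); of weight q − 1 is (q^2 − 1) q ((q+1)(p^m − 1) − (q − 1)) / (2(p^m − 1)); of weight q is (q^2 − 1)(q^2 − q + p^m) / p^m; of weight q + 1 is p^m (q−1)^2 q (q+1) / (2(p^m + 1)); there is exactly one codeword of weight 0 (the zero codeword), and no codewords of any other weight. -/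
section

open Finset

theorem sum_choose_card_filter {G J : Type*} [Fintype G] [Fintype J] (Z : G → J → Prop)
    [∀ g, DecidablePred (Z g)] (k M : ℕ)
    (hM : ∀ S : Finset J, #S = k → #{g | ∀ j ∈ S, Z g j} = M) :
    ∑ g, (#{j | Z g j}).choose k = (Fintype.card J).choose k * M := by
  have hcard (g : G) : (#{j | Z g j}).choose k =
      #(bipartiteAbove (fun g (S : Finset J) => ∀ j ∈ S, Z g j) (powersetCard k univ) g) := by
    rw [← card_powersetCard]
    congr 1
    ext S
    simp only [mem_powersetCard, bipartiteAbove, mem_filter, true_and, subset_iff, mem_univ]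
    tauto
  simp_rw [hcard]
  rw [sum_card_bipartiteAbove_eq_sum_card_bipartiteBelow, sum_congr rfl (g := fun _ => M)]
  · simp
  · intro S hS
    exact hM S (mem_powersetCard.mp hS).2

theorem sum_comp_eq_sum_card_fiber {G : Type*} [Fintype G] (z : G → ℕ) (W : Finset ℕ)
    (hW : ∀ g, z g ∈ W) (f : ℕ → ℕ) :
    ∑ g, f (z g) = ∑ w ∈ W, #{g | z g = w} * f w := by
  rw [← sum_fiberwise_of_maps_to (fun g _ => hW g)]
  refine sum_congr rfl fun w _ => ?_
  rw [sum_congr rfl (g := fun _ => f w) (by simp +contextual)]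
  simp

/-- The solution of the first four moment equations, in truncated arithmetic. -/
theorem moment_equations_solution {q r N₀ N₁ N₂ N : ℕ} (hr : 3 ≤ r) (hrq : r < q)
    (m : ∀ k < 4, N₀ * Nat.descFactorial 0 k + (N₁ * Nat.descFactorial 1 k +
      (N₂ * Nat.descFactorial 2 k + (N * (r + 1).descFactorial k +
        1 * (q + 1).descFactorial k))) = (q + 1).descFactorial k * q ^ (4 - k)) :
    ((r ^ 2 - 1) * r) * N = (q - 1) ^ 2 * q * (q + 1) ∧
    (2 * (r - 1)) * N₂ = (q ^ 2 - 1) * q * ((q + 1) * (r - 1) - (q - 1)) ∧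
    r * N₁ = (q ^ 2 - 1) * (q ^ 2 - q + r) ∧
    (2 * (r + 1)) * N₀ = r * (q - 1) ^ 2 * q * (q + 1) := by
  have m₀ := m 0 (by norm_num)
  have m₁ := m 1 (by norm_num)
  have m₂ := m 2 (by norm_num)
  have m₃ := m 3 (by norm_num)
  simp only [Nat.descFactorial, Nat.sub_zero, Nat.add_sub_cancel] at m₀ m₁ m₂ m₃
  have hr2 : 1 ≤ r ^ 2 := Nat.one_le_pow _ _ (by omega)
  have hq2 : 1 ≤ q ^ 2 := Nat.one_le_pow _ _ (by omega)
  have hqq : q ≤ q ^ 2 := Nat.le_self_pow (by norm_num) q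
  have hle : q - 1 ≤ (q + 1) * (r - 1) :=
    (show q - 1 ≤ q + 1 by omega).trans (Nat.le_mul_of_pos_right _ (by omega))
  have er : r + 1 - 2 = r - 1 := by omega
  have eq' : q + 1 - 2 = q - 1 := by omega
  rw [er, eq'] at m₃
  zify [hr2, hq2, hqq, hle, show 1 ≤ r by omega, show 1 ≤ q by omega] at m₀ m₁ m₂ m₃ ⊢
  norm_num at m₀ m₁ m₂ m₃
  refine ⟨?_, ?_, ?_, ?_⟩
  · linear_combination m₃
  · linear_combination (r - 1 : ℤ) * m₂ - m₃
  · linear_combination (r : ℤ) * (m₁ - m₂) + m₃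
  · linear_combination 2 * (r + 1 : ℤ) * (m₀ - m₁) + (r + 1 : ℤ) * m₂ - m₃

/-- The incidence counts of a system of `q ^ 4` functions on `q + 1` points, any three of which
impose independent conditions, determine how many functions have a given number of zeros. -/
theorem card_zeros_eq_of_incidence {G J : Type*} [Fintype G] [Fintype J] [DecidableEq J]
    (Z : G → J → Prop) [∀ g, DecidablePred (Z g)] {q r : ℕ} (hr : 3 ≤ r) (hrq : r < q)
    (hG : Fintype.card G = q ^ 4) (hJ : Fintype.card J = q + 1)
    (h₁ : ∀ j, #{g | Z g j} = q ^ 3)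
    (h₂ : ∀ j k, j ≠ k → #{g | Z g j ∧ Z g k} = q ^ 2)
    (h₃ : ∀ j k l, j ≠ k → j ≠ l → k ≠ l → #{g | Z g j ∧ Z g k ∧ Z g l} = q)
    (hz : ∀ g, #{j | Z g j} ∈ ({0, 1, 2, r + 1, q + 1} : Finset ℕ))
    (hq : #{g | #{j | Z g j} = q + 1} = 1) :
    ((r ^ 2 - 1) * r) * #{g | #{j | Z g j} = r + 1} = (q - 1) ^ 2 * q * (q + 1) ∧
    (2 * (r - 1)) * #{g | #{j | Z g j} = 2} =
      (q ^ 2 - 1) * q * ((q + 1) * (r - 1) - (q - 1)) ∧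
    r * #{g | #{j | Z g j} = 1} = (q ^ 2 - 1) * (q ^ 2 - q + r) ∧
    (2 * (r + 1)) * #{g | #{j | Z g j} = 0} = r * (q - 1) ^ 2 * q * (q + 1) := by
  have moment (k M : ℕ) hM :=
    (sum_comp_eq_sum_card_fiber _ _ hz (fun n => k.factorial * n.choose k)).symm.trans
      ((mul_sum _ _ _).symm.trans
        ((congrArg (k.factorial * ·) (sum_choose_card_filter Z k M hM)).trans
          (mul_assoc _ _ _).symm))
  have m₀ := moment 0 (q ^ 4) (by simp +contextual [hG])
  have m₁ := moment 1 (q ^ 3) (by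
    intro S hS
    obtain ⟨j, rfl⟩ := card_eq_one.mp hS
    simpa using h₁ j)
  have m₂ := moment 2 (q ^ 2) (by
    intro S hS
    obtain ⟨j, k, hjk, rfl⟩ := card_eq_two.mp hS
    simpa using h₂ j k hjk)
  have m₃ := moment 3 q (by
    intro S hS
    obtain ⟨j, k, l, hjk, hjl, hkl, rfl⟩ := card_eq_three.mp hS
    simpa using h₃ j k l hjk hjl hkl)
  simp only [← Nat.descFactorial_eq_factorial_mul_choose, hJ] at m₀ m₁ m₂ m₃
  rw [sum_insert (by simp), sum_insert (by simp; omega), sum_insert (by simp; omega),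
    sum_insert (by simp; omega), sum_singleton, hq] at m₀ m₁ m₂ m₃
  generalize #{g | #{j | Z g j} = r + 1} = N at *
  generalize #{g | #{j | Z g j} = 2} = N₂ at *
  generalize #{g | #{j | Z g j} = 1} = N₁ at *
  generalize #{g | #{j | Z g j} = 0} = N₀ at *
  refine moment_equations_solution hr hrq fun k hk => ?_
  interval_cases k
  exacts [m₀, m₁, m₂, by simpa using m₃]

/-- The form `(u, v) ↦ Tr ((b ū + a u) v̄ ^ (p ^ i))` attached to `g = (a, b)`, where
`ū = u ^ (p ^ s)` is the conjugate of `u`: additive in both arguments, linear in the first one and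
semilinear in the second one. -/
noncomputable def twistedForm (F : Type*) {K : Type*} [Field F] [Field K] [Algebra F K]
    (p s i : ℕ) (g : K × K) (u v : K) : F :=
  Algebra.trace F K ((g.2 * u ^ p ^ s + g.1 * u) * v ^ p ^ (s + i))

section TwistedForm

variable {F K : Type*} [Field F] [Field K] [Algebra F K] {p s i : ℕ}

theorem twistedForm_sub (g g' : K × K) (u v : K) :
    twistedForm F p s i (g - g') u v = twistedForm F p s i g u v - twistedForm F p s i g' u v := by
  rw [twistedForm, twistedForm, twistedForm, ← map_sub, Prod.fst_sub, Prod.snd_sub]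
  congr 1
  ring

theorem twistedForm_add_left [Fact p.Prime] [CharP K p] (g : K × K) (u u' v : K) :
    twistedForm F p s i g (u + u') v = twistedForm F p s i g u v + twistedForm F p s i g u' v := by
  rw [twistedForm, twistedForm, twistedForm, ← map_add, add_pow_char_pow]
  congr 1
  ring

theorem twistedForm_add_right [Fact p.Prime] [CharP K p] (g : K × K) (u v v' : K) :
    twistedForm F p s i g u (v + v') = twistedForm F p s i g u v + twistedForm F p s i g u v' := by
  rw [twistedForm, twistedForm, twistedForm, ← map_add, add_pow_char_pow]
  congr 1
  ring

theorem twistedForm_smul_left [Fintype F] (hF : Fintype.card F = p ^ s) (g : K × K) (c : F)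
    (u v : K) : twistedForm F p s i g (c • u) v = c * twistedForm F p s i g u v := by
  rw [twistedForm, twistedForm, smul_pow, ← hF, FiniteField.pow_card,
    ← smul_eq_mul (a := c), ← map_smul]
  congr 1
  simp only [Algebra.smul_def]
  ring

theorem twistedForm_smul_right [Fintype F] (hF : Fintype.card F = p ^ s) (g : K × K) (c : F)
    (u v : K) :
    twistedForm F p s i g u (c • v) = c ^ p ^ i * twistedForm F p s i g u v := by
  rw [twistedForm, twistedForm, smul_pow, pow_add, pow_mul c, ← hF, FiniteField.pow_card,
    ← smul_eq_mul (a := c ^ p ^ i), ← map_smul]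
  congr 1
  simp only [Algebra.smul_def]
  ring

theorem twistedForm_smul_smul_eq_zero_iff [Fintype F] (hF : Fintype.card F = p ^ s) (g : K × K)
    {c : F} (hc : c ≠ 0) (u : K) :
    twistedForm F p s i g (c • u) (c • u) = 0 ↔ twistedForm F p s i g u u = 0 := by
  simp [twistedForm_smul_left hF, twistedForm_smul_right hF, hc]

theorem twistedForm_nondegenerate [Fact p.Prime] [CharP K p] [Fintype F] [Fintype K]
    (hF : Fintype.card F = p ^ s) (hK : Fintype.card K = (p ^ s) ^ 2) {g : K × K}
    (h : ∀ u v, twistedForm F p s i g u v = 0) : g = 0 := by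
  classical
  have key (u : K) : g.2 * u ^ p ^ s + g.1 * u = 0 := by
    refine (traceForm_nondegenerate F K).1 _ fun w => ?_
    have hinj : Function.Injective (iterateFrobenius K p (s + i)) := iterateFrobenius_inj K p _
    obtain ⟨v, rfl⟩ := (Finite.injective_iff_surjective.mp hinj) w
    exact h u v
  have hsum : g.1 = -g.2 := eq_neg_of_add_eq_zero_right (by simpa using key 1)
  obtain ⟨ζ, hζ⟩ := IsCyclic.exists_ofOrder_eq_natCard (α := Kˣ)
  rw [Nat.card_eq_fintype_card, Fintype.card_units, hK] at hζ
  have hq : 1 < p ^ s := hF ▸ Fintype.one_lt_card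
  have hζ' : ζ ^ (p ^ s - 1) ≠ 1 :=
    pow_ne_one_of_lt_orderOf (by omega) (by rw [hζ]; exact Nat.sub_lt_sub_right hq.le (by nlinarith))
  have hmul : (g.2 * ζ) * ((ζ : K) ^ (p ^ s - 1) - 1) = 0 := by
    have := key ζ
    rw [hsum, ← Nat.sub_add_cancel hq.le, pow_succ] at this
    linear_combination this
  have hb : g.2 = 0 := by
    rcases mul_eq_zero.mp hmul with h0 | h0
    · simpa using h0
    · exact absurd (Units.ext (by simpa using sub_eq_zero.mp h0)) hζ'
  exact Prod.ext (by simp [hsum, hb]) hb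

theorem bijective_pair_combination [Fintype F] [Fintype K]
    (hcard : Fintype.card K = Fintype.card F ^ 2) {e₁ e₂ : K}
    (he : LinearIndependent F ![e₁, e₂]) :
    Function.Bijective fun x : F × F => x.1 • e₁ + x.2 • e₂ := by
  refine (Fintype.bijective_iff_injective_and_card _).mpr
    ⟨fun x y hxy => ?_, by rw [Fintype.card_prod, hcard, sq]⟩
  have h0 := LinearIndependent.pair_iff.mp he (x.1 - y.1) (x.2 - y.2) (by
    simp only [sub_smul]
    linear_combination (exp := 1) hxy)
  exact Prod.ext (sub_eq_zero.mp h0.1) (sub_eq_zero.mp h0.2)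

/-- Four values which determine a twisted form and can be prescribed arbitrarily. -/
noncomputable def twistedFormValues (F : Type*) {K : Type*} [Field F] [Field K] [Algebra F K]
    (p s i : ℕ) (e₁ e₂ : K) (g : K × K) : F × F × F × F :=
  (twistedForm F p s i g e₁ e₁, twistedForm F p s i g e₂ e₂,
    twistedForm F p s i g (e₁ + e₂) (e₁ + e₂), twistedForm F p s i g e₁ e₂)

theorem eq_zero_of_twistedFormValues_eq_zero [Fact p.Prime] [CharP K p] [Fintype F] [Fintype K]
    (hF : Fintype.card F = p ^ s) (hK : Fintype.card K = (p ^ s) ^ 2) {e₁ e₂ : K}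
    (he : LinearIndependent F ![e₁, e₂]) {g : K × K}
    (hg : twistedFormValues F p s i e₁ e₂ g = 0) : g = 0 := by
  simp only [twistedFormValues, Prod.mk_eq_zero, twistedForm_add_left,
    twistedForm_add_right] at hg
  obtain ⟨h₁, h₂, h₃, h₄⟩ := hg
  have h₅ : twistedForm F p s i g e₂ e₁ = 0 := by simpa [h₁, h₂, h₄] using h₃
  refine twistedForm_nondegenerate (i := i) hF hK fun u v => ?_
  have hb := (bijective_pair_combination (by rw [hK, hF]) he).surjective
  obtain ⟨x, rfl⟩ := hb u
  obtain ⟨y, rfl⟩ := hb v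
  simp [twistedForm_add_left, twistedForm_add_right, twistedForm_smul_left hF,
    twistedForm_smul_right hF, h₁, h₂, h₄, h₅]

theorem bijective_twistedFormValues [Fact p.Prime] [CharP K p] [Fintype F] [Fintype K]
    (hF : Fintype.card F = p ^ s) (hK : Fintype.card K = (p ^ s) ^ 2) {e₁ e₂ : K}
    (he : LinearIndependent F ![e₁, e₂]) :
    Function.Bijective (twistedFormValues F p s i e₁ e₂) := by
  refine (Fintype.bijective_iff_injective_and_card _).mpr ⟨fun g g' hg => ?_, ?_⟩
  · refine sub_eq_zero.mp (eq_zero_of_twistedFormValues_eq_zero (i := i) hF hK he ?_)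
    simp only [twistedFormValues, Prod.mk.injEq] at hg
    simp [twistedFormValues, twistedForm_sub, hg]
  · simp only [Fintype.card_prod, hF, hK]
    ring

theorem card_filter_twistedFormValues_mem [Fact p.Prime] [CharP K p] [Fintype F] [Fintype K]
    [DecidableEq F]
    (hF : Fintype.card F = p ^ s) (hK : Fintype.card K = (p ^ s) ^ 2) {e₁ e₂ : K}
    (he : LinearIndependent F ![e₁, e₂]) (S : Finset (F × F × F × F)) :
    #{g | twistedFormValues F p s i e₁ e₂ g ∈ S} = #S :=
  card_equiv (Equiv.ofBijective _ (bijective_twistedFormValues (i := i) hF hK he)) (by simp)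

end TwistedForm

theorem FiniteField.card_filter_pow_pow_eq_self {F : Type*} [Field F] [Fintype F] [DecidableEq F]
    {p s i : ℕ} [Fact p.Prime] (hF : Fintype.card F = p ^ s) :
    #{t : F | t ^ p ^ i = t} = p ^ Nat.gcd i s := by
  have hp : 0 < p := (Fact.out : p.Prime).pos
  have hker := IsCyclic.card_powMonoidHom_ker Fˣ (p ^ i - 1)
  rw [Nat.card_eq_fintype_card (α := Fˣ), Fintype.card_units, hF, Nat.pow_sub_one_gcd_pow_sub_one,
    Nat.gcd_comm] at hker
  have hzero : (0 : F) ∈ ({t : F | t ^ p ^ i = t} : Finset F) := by simp [hp.ne']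
  have hunits : #(({t : F | t ^ p ^ i = t} : Finset F).erase 0) =
      Nat.card (powMonoidHom (p ^ i - 1) : Fˣ →* Fˣ).ker := by
    rw [Nat.card_eq_fintype_card, ← card_univ]
    symm
    refine card_nbij (fun x => ((x : Fˣ) : F)) ?_ ?_ ?_
    · rintro ⟨x, hx⟩ -
      rw [MonoidHom.mem_ker, powMonoidHom_apply] at hx
      have : (x : F) ^ (p ^ i - 1) = 1 := by simpa using congrArg Units.val hx
      refine mem_coe.mpr (mem_erase.mpr ⟨x.ne_zero, mem_filter.mpr ⟨mem_univ _, ?_⟩⟩)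
      change (x : F) ^ p ^ i = x
      rw [← Nat.sub_add_cancel (Nat.one_le_pow i p hp), pow_succ, this, one_mul]
    · intro x _ y _ hxy
      exact Subtype.ext (Units.ext hxy)
    · intro t ht
      obtain ⟨h0, ht⟩ := mem_erase.mp (mem_coe.mp ht)
      rw [mem_filter] at ht
      refine ⟨⟨Units.mk0 t h0, ?_⟩, by simp, rfl⟩
      rw [MonoidHom.mem_ker, powMonoidHom_apply]
      refine Units.ext (mul_right_cancel₀ h0 ?_)
      simp only [Units.val_pow_eq_pow_val, Units.val_mk0, Units.val_one]
      rw [← pow_succ, Nat.sub_add_cancel (Nat.one_le_pow i p hp), ht.2, one_mul]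
  rw [← card_erase_add_one hzero, hunits, hker,
    Nat.sub_add_cancel (Nat.one_le_pow _ p hp)]

theorem exists_smul_eq_of_pairwise_linearIndependent {F K J : Type*} [Field F] [Field K]
    [Algebra F K] [Fintype F] [Fintype K] [Fintype J]
    (hcard : Fintype.card K = Fintype.card F ^ 2) (hJ : Fintype.card J = Fintype.card F + 1)
    {u : J → K} (hu : ∀ j k, j ≠ k → LinearIndependent F ![u j, u k]) {v : K} (hv : v ≠ 0) :
    ∃ (c : F) (j : J), c ≠ 0 ∧ v = c • u j := by
  classical
  have hF : 1 < Fintype.card F := Fintype.one_lt_card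
  have : Nontrivial J := Fintype.one_lt_card_iff_nontrivial.mp (by omega)
  have hu0 (j : J) : u j ≠ 0 := by
    obtain ⟨k, hk⟩ := exists_ne j
    exact (hu j k hk.symm).ne_zero 0
  let f : Fˣ × J → {v : K // v ≠ 0} :=
    fun x => ⟨(x.1 : F) • u x.2, smul_ne_zero x.1.ne_zero (hu0 x.2)⟩
  have hf : Function.Bijective f := by
    refine (Fintype.bijective_iff_injective_and_card f).mpr ⟨?_, ?_⟩
    · rintro ⟨c, j⟩ ⟨d, k⟩ hcd
      have hcd' : (c : F) • u j = (d : F) • u k := congrArg Subtype.val hcd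
      obtain rfl : j = k := by
        by_contra hjk
        have := LinearIndependent.pair_iff.mp (hu j k hjk) c (-d) (by rw [hcd', neg_smul]; simp)
        exact c.ne_zero this.1
      exact Prod.ext (Units.ext (smul_left_injective F (hu0 j) hcd')) rfl
    · rw [Fintype.card_prod, Fintype.card_units, hJ, Fintype.card_subtype_compl,
        Fintype.card_subtype_eq, hcard, mul_comm, ← one_pow 2, Nat.sq_sub_sq]
      simp
  obtain ⟨⟨c, j⟩, h⟩ := hf.surjective ⟨v, hv⟩
  exact ⟨c, j, c.ne_zero, (congrArg Subtype.val h).symm⟩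

/-- Three pairwise independent vectors of a plane are, up to scalars, of the form
`e₁`, `e₂`, `e₁ + e₂`. -/
theorem exists_smul_add_smul_eq {F K : Type*} [Field F] [Field K] [Algebra F K] [Fintype F]
    [Fintype K] (hcard : Fintype.card K = Fintype.card F ^ 2) {u v w : K}
    (huv : LinearIndependent F ![u, v]) (huw : LinearIndependent F ![u, w])
    (hvw : LinearIndependent F ![v, w]) :
    ∃ x y : F, x ≠ 0 ∧ y ≠ 0 ∧ w = x • u + y • v ∧ LinearIndependent F ![x • u, y • v] := by
  obtain ⟨⟨x, y⟩, hxy⟩ := (bijective_pair_combination hcard huv).surjective w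
  simp only at hxy
  have hx : x ≠ 0 := by
    rintro rfl
    have := LinearIndependent.pair_iff.mp hvw y (-1) (by simp [← hxy])
    simp at this
  have hy : y ≠ 0 := by
    rintro rfl
    have := LinearIndependent.pair_iff.mp huw x (-1) (by simp [← hxy])
    simp at this
  refine ⟨x, y, hx, hy, hxy.symm, LinearIndependent.pair_iff.mpr fun a b hab => ?_⟩
  have := LinearIndependent.pair_iff.mp huv (a * x) (b * y) (by simpa [mul_smul] using hab)
  simpa [hx, hy] using this

section Incidence

variable {F K J : Type*} [Field F] [Field K] [Algebra F K] [Fintype F] [Fintype K] [DecidableEq F]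
  [Fintype J] {p s i : ℕ} [Fact p.Prime] [CharP K p]

theorem card_filter_twistedForm_eq_zero_of_ne (hF : Fintype.card F = p ^ s)
    (hK : Fintype.card K = (p ^ s) ^ 2) {e₁ e₂ : K} (he : LinearIndependent F ![e₁, e₂]) :
    #{g : K × K | twistedForm F p s i g e₁ e₁ = 0} = (p ^ s) ^ 3 := by
  have := card_filter_twistedFormValues_mem (i := i) hF hK he ({0} ×ˢ univ)
  simp only [twistedFormValues, mem_product, mem_singleton, mem_univ, and_true, card_product,
    card_singleton, card_univ, Fintype.card_prod, hF] at this
  rw [this]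
  ring

theorem card_filter_twistedForm_pair_eq_zero (hF : Fintype.card F = p ^ s)
    (hK : Fintype.card K = (p ^ s) ^ 2) {e₁ e₂ : K} (he : LinearIndependent F ![e₁, e₂]) :
    #{g : K × K | twistedForm F p s i g e₁ e₁ = 0 ∧ twistedForm F p s i g e₂ e₂ = 0} =
      (p ^ s) ^ 2 := by
  have := card_filter_twistedFormValues_mem (i := i) hF hK he ({0} ×ˢ {0} ×ˢ univ)
  simp only [twistedFormValues, mem_product, mem_singleton, mem_univ, and_true, card_product,
    card_singleton, card_univ, Fintype.card_prod, hF] at this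
  rw [this]
  ring

theorem card_filter_twistedForm_triple_eq_zero (hF : Fintype.card F = p ^ s)
    (hK : Fintype.card K = (p ^ s) ^ 2) {e₁ e₂ : K} (he : LinearIndependent F ![e₁, e₂]) :
    #{g : K × K | twistedForm F p s i g e₁ e₁ = 0 ∧ twistedForm F p s i g e₂ e₂ = 0 ∧
      twistedForm F p s i g (e₁ + e₂) (e₁ + e₂) = 0} = p ^ s := by
  have := card_filter_twistedFormValues_mem (i := i) hF hK he ({0} ×ˢ {0} ×ˢ {0} ×ˢ univ)
  simp only [twistedFormValues, mem_product, mem_singleton, mem_univ, and_true, card_product,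
    card_singleton, card_univ, hF] at this
  rw [this]
  ring

/-- A nonzero twisted form vanishing at three points vanishes exactly on a subline. -/
theorem card_zeros_twistedForm_eq (hF : Fintype.card F = p ^ s)
    (hK : Fintype.card K = (p ^ s) ^ 2) (hJ : Fintype.card J = p ^ s + 1) {u : J → K}
    (hu : ∀ j k, j ≠ k → LinearIndependent F ![u j, u k]) {g : K × K} (hg : g ≠ 0)
    {e₁ e₂ : K} (he : LinearIndependent F ![e₁, e₂])
    (h₁ : twistedForm F p s i g e₁ e₁ = 0) (h₂ : twistedForm F p s i g e₂ e₂ = 0)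
    (h₃ : twistedForm F p s i g (e₁ + e₂) (e₁ + e₂) = 0) :
    #{j | twistedForm F p s i g (u j) (u j) = 0} = p ^ Nat.gcd i s + 1 := by
  have hcard : Fintype.card K = Fintype.card F ^ 2 := by rw [hK, hF]
  let vec : Option F → K := fun o => o.elim e₁ fun t => t • e₁ + e₂
  have hvec0 (o : Option F) : vec o ≠ 0 := by
    cases o with
    | none => exact he.ne_zero 0
    | some t =>
      intro h0
      have := LinearIndependent.pair_iff.mp he t 1 (by simpa [vec] using h0)
      simp at this
  choose c σ hc hσ using fun o =>
    exists_smul_eq_of_pairwise_linearIndependent hcard (by rw [hJ, hF]) hu (hvec0 o)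
  have hinj : Function.Injective σ := by
    intro o o' ho
    have hprop : c o' • vec o - c o • vec o' = 0 := by
      rw [hσ o, hσ o', ho, smul_smul, smul_smul, mul_comm, sub_self]
    cases o with
    | none =>
      cases o' with
      | none => rfl
      | some t =>
        have := LinearIndependent.pair_iff.mp he (c (some t) - c none * t) (-c none) (by
          rw [← hprop]
          simp only [vec, Option.elim, Algebra.smul_def, map_sub, map_neg, map_mul]
          ring)
        exact absurd (neg_eq_zero.mp this.2) (hc _)
    | some t =>
      cases o' with
      | none =>
        have := LinearIndependent.pair_iff.mp he (c none * t - c (some t)) (c none) (by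
          rw [← hprop]
          simp only [vec, Option.elim, Algebra.smul_def, map_sub, map_mul]
          ring)
        exact absurd this.2 (hc _)
      | some t' =>
        have := LinearIndependent.pair_iff.mp he (c (some t') * t - c (some t) * t')
          (c (some t') - c (some t)) (by
            rw [← hprop]
            simp only [vec, Option.elim, Algebra.smul_def, map_sub, map_mul]
            ring)
        rw [sub_eq_zero.mp this.2] at this
        rw [mul_left_cancel₀ (hc _) (sub_eq_zero.mp this.1)]
  have hbij : Function.Bijective σ := (Fintype.bijective_iff_injective_and_card σ).mpr
    ⟨hinj, by rw [Fintype.card_option, hF, hJ]⟩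
  have h₂₁ : twistedForm F p s i g e₂ e₁ = -twistedForm F p s i g e₁ e₂ := by
    simp only [twistedForm_add_left, twistedForm_add_right, h₁, h₂] at h₃
    linear_combination h₃
  have h₁₂ : twistedForm F p s i g e₁ e₂ ≠ 0 := fun h0 =>
    hg (eq_zero_of_twistedFormValues_eq_zero (i := i) hF hK he
      (by simp [twistedFormValues, h₁, h₂, h₃, h0]))
  have hzero (o : Option F) : twistedForm F p s i g (u (σ o)) (u (σ o)) = 0 ↔
      o.elim True fun t => t ^ p ^ i = t := by
    rw [← twistedForm_smul_smul_eq_zero_iff hF g (hc o), ← hσ o]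
    cases o with
    | none => simpa [vec] using h₁
    | some t =>
      have : twistedForm F p s i g (t • e₁ + e₂) (t • e₁ + e₂) =
          (t - t ^ p ^ i) * twistedForm F p s i g e₁ e₂ := by
        simp only [twistedForm_add_left, twistedForm_add_right, twistedForm_smul_left hF,
          twistedForm_smul_right hF, h₁, h₂, h₂₁]
        ring
      simp only [vec, Option.elim, this, mul_eq_zero, h₁₂, or_false, sub_eq_zero]
      exact eq_comm
  rw [← FiniteField.card_filter_pow_pow_eq_self hF,
    ← card_equiv (s := {o | twistedForm F p s i g (u (σ o)) (u (σ o)) = 0})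
      (Equiv.ofBijective σ hbij) (by simp), card_filter, Fintype.sum_option, add_comm, card_filter]
  simp [hzero]

/-- The number of zeros of a nonzero twisted form on the projective line. -/
theorem card_zeros_twistedForm_mem (hF : Fintype.card F = p ^ s)
    (hK : Fintype.card K = (p ^ s) ^ 2) (hJ : Fintype.card J = p ^ s + 1) {u : J → K}
    (hu : ∀ j k, j ≠ k → LinearIndependent F ![u j, u k]) {g : K × K} (hg : g ≠ 0) :
    #{j | twistedForm F p s i g (u j) (u j) = 0} ∈
      ({0, 1, 2, p ^ Nat.gcd i s + 1} : Finset ℕ) := by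
  by_cases hlt : #{j | twistedForm F p s i g (u j) (u j) = 0} ≤ 2
  · simp only [mem_insert, mem_singleton]
    omega
  obtain ⟨j, k, l, hj, hk, hl, hjk, hjl, hkl⟩ := two_lt_card_iff.mp (not_le.mp hlt)
  simp only [mem_filter, mem_univ, true_and] at hj hk hl
  obtain ⟨x, y, hx, hy, hl', he⟩ := exists_smul_add_smul_eq (by rw [hK, hF])
    (hu j k hjk) (hu j l hjl) (hu k l hkl)
  rw [← twistedForm_smul_smul_eq_zero_iff hF g hx] at hj
  rw [← twistedForm_smul_smul_eq_zero_iff hF g hy] at hk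
  rw [hl'] at hl
  rw [card_zeros_twistedForm_eq hF hK hJ hu hg he hj hk hl]
  simp

/-- Only the zero form vanishes on the whole projective line. -/
theorem card_zeros_twistedForm_eq_card_iff (hF : Fintype.card F = p ^ s)
    (hK : Fintype.card K = (p ^ s) ^ 2) (hJ : Fintype.card J = p ^ s + 1) {u : J → K}
    (hu : ∀ j k, j ≠ k → LinearIndependent F ![u j, u k]) (hr : 3 ≤ p ^ Nat.gcd i s)
    (hrq : p ^ Nat.gcd i s < p ^ s) {g : K × K} :
    #{j | twistedForm F p s i g (u j) (u j) = 0} = p ^ s + 1 ↔ g = 0 := by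
  refine ⟨fun h => ?_, ?_⟩
  · by_contra hg
    have := card_zeros_twistedForm_mem (i := i) hF hK hJ hu hg
    rw [h] at this
    simp only [mem_insert, mem_singleton] at this
    omega
  · rintro rfl
    simp [twistedForm, hJ]

/-- The distribution of the number of zeros of twisted forms on the projective line. -/
theorem card_twistedForm_zeros (hF : Fintype.card F = p ^ s)
    (hK : Fintype.card K = (p ^ s) ^ 2) (hJ : Fintype.card J = p ^ s + 1) {u : J → K}
    (hu : ∀ j k, j ≠ k → LinearIndependent F ![u j, u k]) {q r : ℕ} (hq : q = p ^ s)
    (hr : r = p ^ Nat.gcd i s) (hr3 : 3 ≤ r) (hrq : r < q) :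
    ((r ^ 2 - 1) * r) *
        #{g : K × K | #{j | twistedForm F p s i g (u j) (u j) = 0} = r + 1} =
      (q - 1) ^ 2 * q * (q + 1) ∧
    (2 * (r - 1)) * #{g : K × K | #{j | twistedForm F p s i g (u j) (u j) = 0} = 2} =
      (q ^ 2 - 1) * q * ((q + 1) * (r - 1) - (q - 1)) ∧
    r * #{g : K × K | #{j | twistedForm F p s i g (u j) (u j) = 0} = 1} =
      (q ^ 2 - 1) * (q ^ 2 - q + r) ∧
    (2 * (r + 1)) * #{g : K × K | #{j | twistedForm F p s i g (u j) (u j) = 0} = 0} =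
      r * (q - 1) ^ 2 * q * (q + 1) := by
  classical
  subst hq hr
  have : Nontrivial J := Fintype.one_lt_card_iff_nontrivial.mp (by omega)
  have hzero {g : K × K} :=
    card_zeros_twistedForm_eq_card_iff (i := i) hF hK hJ hu hr3 hrq (g := g)
  refine card_zeros_eq_of_incidence (fun g j => twistedForm F p s i g (u j) (u j) = 0) hr3 hrq
    (by rw [Fintype.card_prod, hK]; ring) hJ (fun j => ?_) (fun j k hjk => ?_)
    (fun j k l hjk hjl hkl => ?_) (fun g => ?_) ?_
  · obtain ⟨k, hk⟩ := exists_ne j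
    exact card_filter_twistedForm_eq_zero_of_ne hF hK (hu j k hk.symm)
  · exact card_filter_twistedForm_pair_eq_zero hF hK (hu j k hjk)
  · obtain ⟨x, y, hx, hy, hl, he⟩ := exists_smul_add_smul_eq (by rw [hK, hF])
      (hu j k hjk) (hu j l hjl) (hu k l hkl)
    rw [← card_filter_twistedForm_triple_eq_zero (i := i) hF hK he, ← hl]
    simp only [twistedForm_smul_smul_eq_zero_iff hF _ hx, twistedForm_smul_smul_eq_zero_iff hF _ hy]
  · by_cases hg : g = 0
    · rw [hzero.mpr hg]
      simp
    · have := card_zeros_twistedForm_mem (i := i) hF hK hJ hu hg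
      simp only [mem_insert, mem_singleton] at this ⊢
      tauto
  · exact card_eq_one.mpr ⟨0, by ext g; simpa using hzero⟩

end Incidence

theorem trace_eq_zero_iff_add_pow_card {F K : Type*} [Field F] [Field K] [Algebra F K] [Fintype F]
    [Fintype K] (hcard : Fintype.card K = Fintype.card F ^ 2) (y : K) :
    Algebra.trace F K y = 0 ↔ y + y ^ Fintype.card F = 0 := by
  have hrank : Module.finrank F K = 2 :=
    Nat.pow_right_injective Fintype.one_lt_card
      (Module.card_eq_pow_finrank (K := F) (V := K) ▸ hcard)
  rw [← map_eq_zero_iff _ (algebraMap F K).injective, FiniteField.algebraMap_trace_eq_sum_pow,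
    hrank, sum_range_succ, sum_range_one, Nat.card_eq_fintype_card, pow_zero, pow_one, pow_one]

section Codeword

variable {F K : Type*} [Field F] [Field K] [Algebra F K] [Fintype F] [Fintype K]
  {p s i h : ℕ} [Fact p.Prime] [CharP K p]

theorem trace_eq_zero_iff_twistedForm (hF : Fintype.card F = p ^ s)
    (hK : Fintype.card K = (p ^ s) ^ 2) {x v : K} (hv : v ≠ 0) (hx : x ^ p ^ s * x = 1)
    (hxv : v ^ p ^ s = x * v) (hh : x ^ (2 * h + 1) = x ^ p ^ i) (a b : K) :
    Algebra.trace F K (a * x ^ h + b * x ^ (h + 1)) = 0 ↔ twistedForm F p s i (a, b) v v = 0 := by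
  have hx0 : x ≠ 0 := right_ne_zero_of_mul_eq_one hx
  have hz (n : ℕ) : (x ^ n) ^ p ^ s * x ^ n = 1 := by rw [pow_right_comm, ← mul_pow, hx, one_pow]
  have hy : (a * x ^ h + b * x ^ (h + 1)) ^ p ^ s =
      a ^ p ^ s * (x ^ h) ^ p ^ s + b ^ p ^ s * ((x ^ h) ^ p ^ s * x ^ p ^ s) := by
    rw [add_pow_char_pow, mul_pow, mul_pow, pow_succ, mul_pow]
  have hy' : ((b * (x * v) + a * v) * (x ^ p ^ i * v ^ p ^ i)) ^ p ^ s =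
      (b ^ p ^ s * (x ^ p ^ s * (x * v)) + a ^ p ^ s * (x * v)) *
        ((x ^ p ^ i) ^ p ^ s * (x ^ p ^ i * v ^ p ^ i)) := by
    rw [mul_pow, add_pow_char_pow, mul_pow, mul_pow, mul_pow, mul_pow, pow_right_comm v, hxv,
      mul_pow x v]
  rw [twistedForm, trace_eq_zero_iff_add_pow_card (by rw [hK, hF]),
    trace_eq_zero_iff_add_pow_card (by rw [hK, hF]), hF, pow_add p s i, pow_mul v, hxv, mul_pow x v,
    hy, hy', ← mul_eq_zero_iff_left
      (mul_ne_zero (pow_ne_zero (h + 1) hx0) (pow_ne_zero (p ^ i + 1) hv))]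
  refine Eq.congr_left ?_
  linear_combination v ^ (p ^ i + 1) * ((a + b * x) * hh +
    (a ^ p ^ s * x + b ^ p ^ s * x ^ p ^ s * x) * (hz h - hz (p ^ i)))

theorem trace_eq_zero_iff_twistedForm_conj (hF : Fintype.card F = p ^ s)
    (hK : Fintype.card K = (p ^ s) ^ 2) {x v : K} (hv : v ≠ 0) (hx : x ^ p ^ s * x = 1)
    (hxv : v ^ p ^ s = x * v) (hh : x ^ (2 * h + 1) * x ^ p ^ i = 1) (a b : K) :
    Algebra.trace F K (a * x ^ h + b * x ^ (h + 1)) = 0 ↔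
      twistedForm F p s i (b ^ p ^ s, a ^ p ^ s) v v = 0 := by
  have hx0 : x ≠ 0 := right_ne_zero_of_mul_eq_one hx
  have hz (n : ℕ) : (x ^ n) ^ p ^ s * x ^ n = 1 := by rw [pow_right_comm, ← mul_pow, hx, one_pow]
  have hconj (c : K) : (c ^ p ^ s) ^ p ^ s = c := by
    rw [← pow_mul, ← sq, ← hK, FiniteField.pow_card]
  have hy : (a * x ^ h + b * x ^ (h + 1)) ^ p ^ s =
      a ^ p ^ s * (x ^ h) ^ p ^ s + b ^ p ^ s * ((x ^ h) ^ p ^ s * x ^ p ^ s) := by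
    rw [add_pow_char_pow, mul_pow, mul_pow, pow_succ, mul_pow]
  have hy' : ((a ^ p ^ s * (x * v) + b ^ p ^ s * v) * (x ^ p ^ i * v ^ p ^ i)) ^ p ^ s =
      (a * (x ^ p ^ s * (x * v)) + b * (x * v)) *
        ((x ^ p ^ i) ^ p ^ s * (x ^ p ^ i * v ^ p ^ i)) := by
    rw [mul_pow, add_pow_char_pow, mul_pow, mul_pow, mul_pow, mul_pow, pow_right_comm v, hxv,
      mul_pow x v, hconj, hconj]
  rw [twistedForm, trace_eq_zero_iff_add_pow_card (by rw [hK, hF]),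
    trace_eq_zero_iff_add_pow_card (by rw [hK, hF]), hF, pow_add p s i, pow_mul v, hxv, mul_pow x v,
    hy, hy', ← mul_eq_zero_iff_left (mul_ne_zero (pow_ne_zero (h + 1) hx0)
      (mul_ne_zero (pow_ne_zero (p ^ i) hx0) (pow_ne_zero (p ^ i + 1) hv)))]
  refine Eq.congr_left ?_
  linear_combination v ^ (p ^ i + 1) * ((a + b * x) * hh +
    x ^ p ^ i * (a ^ p ^ s * x + b ^ p ^ s * x ^ p ^ s * x) * hz h -
    (a * x ^ p ^ s * x + b * x) * hz (p ^ i) + (b ^ p ^ s * x ^ p ^ i - a) * hx)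

end Codeword

/-- Hilbert 90 for a quadratic extension of finite fields. -/
theorem exists_pow_eq_mul_of_pow_add_one_eq_one {K : Type*} [Field K] [Fintype K] {q : ℕ}
    (hK : Fintype.card K = q ^ 2) {β : K} (hβ : β ^ (q + 1) = 1) :
    ∃ γ : K, γ ≠ 0 ∧ γ ^ q = β * γ := by
  classical
  have hq : 1 ≤ q := Nat.one_le_iff_ne_zero.mpr fun h0 => by
    simp [h0] at hK
  obtain ⟨ζ, hζ⟩ := IsCyclic.exists_generator (α := Kˣ)
  have hord : orderOf ζ = (q + 1) * (q - 1) := by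
    rw [orderOf_eq_card_of_forall_mem_zpowers hζ, Nat.card_eq_fintype_card, Fintype.card_units,
      hK, ← Nat.sq_sub_sq, one_pow]
  have hβ0 : β ≠ 0 := by
    rintro rfl
    simp at hβ
  obtain ⟨k, hk : ζ ^ k = Units.mk0 β hβ0⟩ :=
    mem_powers_iff_mem_zpowers.mpr (hζ (Units.mk0 β hβ0))
  have hdvd : (q + 1) * (q - 1) ∣ (q + 1) * k := by
    rw [← hord, mul_comm]
    refine orderOf_dvd_of_pow_eq_one ?_
    rw [pow_mul, hk]
    exact Units.ext (by simpa using hβ)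
  obtain ⟨l, rfl⟩ := Nat.dvd_of_mul_dvd_mul_left q.succ_pos hdvd
  refine ⟨(ζ ^ l : Kˣ), Units.ne_zero _, ?_⟩
  have hval : (ζ : K) ^ ((q - 1) * l) = β := by simpa using congrArg Units.val hk
  rw [← hval, Units.val_pow_eq_pow_val, ← pow_mul, ← pow_add]
  congr 1
  rw [← Nat.succ_mul, Nat.succ_eq_add_one, Nat.sub_add_cancel hq, mul_comm]

/-- The powers of `γ` represent distinct points of the projective line. -/
theorem linearIndependent_pow_pair {F K : Type*} [Field F] [Field K] [Algebra F K] [Fintype F]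
    {q : ℕ} (hF : Fintype.card F = q) {β γ : K} (hβ : IsPrimitiveRoot β (q + 1)) (hγ : γ ≠ 0)
    (hγβ : γ ^ q = β * γ) {j k : Fin (q + 1)} (hjk : j ≠ k) :
    LinearIndependent F ![γ ^ (j : ℕ), γ ^ (k : ℕ)] := by
  refine (LinearIndependent.pair_iff' (pow_ne_zero _ hγ)).mpr fun c hc => hjk ?_
  have hpow := congrArg (· ^ q) hc
  simp only [smul_pow] at hpow
  rw [pow_right_comm, pow_right_comm γ k, hγβ, mul_pow, mul_pow, ← hc,
    show c ^ q = c by rw [← hF, FiniteField.pow_card]] at hpow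
  have hne : c • γ ^ (j : ℕ) ≠ 0 := hc ▸ pow_ne_zero _ hγ
  rw [← mul_smul_comm] at hpow
  exact Fin.ext (hβ.pow_inj j.isLt k.isLt (mul_right_cancel₀ hne hpow))

theorem ncard_range_hammingNorm_eq {G ι F : Type*} [Fintype G] [Fintype ι] [Zero F]
    [DecidableEq F] {E : G → ι → F} (hE : Function.Injective E) {N : ℕ}
    (hN : Fintype.card ι = N) {w k : ℕ} (hwk : w + k = N) :
    {c ∈ Set.range E | hammingNorm c = w}.ncard = #{g | #{j | E g j = 0} = k} := by
  have hsum (c : ι → F) : #{j | c j = 0} + hammingNorm c = N := by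
    rw [hammingNorm, card_filter_add_card_filter_not, card_univ, hN]
  rw [← Set.ncard_coe_finset, ← Set.ncard_image_of_injective _ hE]
  congr 1
  ext c
  simp only [Set.mem_range, Set.mem_image, coe_filter, mem_univ, true_and]
  constructor
  · rintro ⟨⟨g, rfl⟩, hw⟩
    exact ⟨g, by have := hsum (E g); simp only [Set.mem_ofPred_eq]; omega, rfl⟩
  · rintro ⟨g, hg, rfl⟩
    exact ⟨⟨g, rfl⟩, by have := hsum (E g); simp only [Set.mem_ofPred_eq] at hg; omega⟩


end

theorem stmt12 (p s : ℕ) (hp : p.Prime) (hs : 1 < s) (q : ℕ) (hq : q = p ^ s)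
    (i m : ℕ) (hi0 : 0 < i) (his : i < s) (hm : m = Nat.gcd i s) (hpm : 3 ≤ p ^ m)
    (h : ℕ) (hh : 2 * h = q - p ^ i ∨ (Odd p ∧ 2 * h = p ^ i - 1))
    (F K : Type) [Field F] [Field K] [Fintype F] [Fintype K] [DecidableEq F]
    [Algebra F K] (hF : Fintype.card F = q) (hK : Fintype.card K = q ^ 2)
    (β : K) (hβ : IsPrimitiveRoot β (q + 1))
    (D : Set (Fin (q + 1) → F))
    (hD : D = {c | ∃ a b : K, ∀ j : Fin (q + 1),
      c j = Algebra.trace F K (a * β ^ (h * (j : ℕ)) + b * β ^ ((h + 1) * (j : ℕ)))}) :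
    ((p ^ (2 * m) - 1) * p ^ m) * {c ∈ D | hammingNorm c = q - p ^ m}.ncard =
        (q - 1) ^ 2 * q * (q + 1) ∧
    (2 * (p ^ m - 1)) * {c ∈ D | hammingNorm c = q - 1}.ncard =
        (q ^ 2 - 1) * q * ((q + 1) * (p ^ m - 1) - (q - 1)) ∧
    p ^ m * {c ∈ D | hammingNorm c = q}.ncard =
        (q ^ 2 - 1) * (q ^ 2 - q + p ^ m) ∧
    (2 * (p ^ m + 1)) * {c ∈ D | hammingNorm c = q + 1}.ncard =
        p ^ m * (q - 1) ^ 2 * q * (q + 1) ∧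
    {c ∈ D | hammingNorm c = 0}.ncard = 1 ∧
    ∀ w : ℕ, w ∉ ({0, q - p ^ m, q - 1, q, q + 1} : Set ℕ) →
      {c ∈ D | hammingNorm c = w}.ncard = 0 := by
  have := Fact.mk hp
  have : CharP F p := charP_of_card_eq_prime_pow (hF.trans hq)
  have : CharP K p := charP_of_injective_algebraMap (algebraMap F K).injective p
  subst hq
  have hgcd : p ^ m < p ^ s := Nat.pow_lt_pow_right hp.one_lt
    ((hm ▸ Nat.gcd_le_left s hi0).trans_lt his)
  have hlt : p ^ i < p ^ s := Nat.pow_lt_pow_right hp.one_lt his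
  obtain ⟨γ, hγ, hγβ⟩ := exists_pow_eq_mul_of_pow_add_one_eq_one hK hβ.pow_eq_one
  have hu (j k : Fin (p ^ s + 1)) (hjk : j ≠ k) :=
    linearIndependent_pow_pair hF hβ hγ hγβ hjk
  obtain ⟨σ, hσ⟩ : ∃ σ : K × K ≃ K × K, ∀ (g : K × K) (j : Fin (p ^ s + 1)),
      Algebra.trace F K (g.1 * β ^ (h * (j : ℕ)) + g.2 * β ^ ((h + 1) * (j : ℕ))) = 0 ↔
        twistedForm F p s i (σ g) (γ ^ (j : ℕ)) (γ ^ (j : ℕ)) = 0 := by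
    have hx (j : ℕ) : (β ^ j) ^ p ^ s * β ^ j = 1 := by
      rw [← pow_succ, pow_right_comm, hβ.pow_eq_one, one_pow]
    have hxv (j : ℕ) : (γ ^ j) ^ p ^ s = β ^ j * γ ^ j := by rw [pow_right_comm, hγβ, mul_pow]
    simp only [mul_comm _ (Fin.val _), pow_mul β]
    rcases hh with hh | ⟨-, hh⟩
    · have hinj : Function.Injective fun g : K × K => (g.2 ^ p ^ s, g.1 ^ p ^ s) := by
        intro g g' hg
        simp only [Prod.mk.injEq] at hg
        exact Prod.ext (iterateFrobenius_inj K p s hg.2) (iterateFrobenius_inj K p s hg.1)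
      refine ⟨Equiv.ofBijective _ (Finite.injective_iff_bijective.mp hinj), fun g j =>
        trace_eq_zero_iff_twistedForm_conj hF hK (pow_ne_zero _ hγ) (hx j) (hxv j) ?_ g.1 g.2⟩
      rw [← pow_add, show 2 * h + 1 + p ^ i = p ^ s + 1 by omega, pow_right_comm, hβ.pow_eq_one,
        one_pow]
    · refine ⟨Equiv.refl _, fun g j =>
        trace_eq_zero_iff_twistedForm hF hK (pow_ne_zero _ hγ) (hx j) (hxv j) ?_ g.1 g.2⟩
      rw [show 2 * h + 1 = p ^ i by have := Nat.one_le_pow i p hp.pos; omega]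
  let E : K × K → Fin (p ^ s + 1) → F := fun g j =>
    Algebra.trace F K (g.1 * β ^ (h * (j : ℕ)) + g.2 * β ^ ((h + 1) * (j : ℕ)))
  have hJ : Fintype.card (Fin (p ^ s + 1)) = p ^ s + 1 := Fintype.card_fin _
  have hzero {g : K × K} :=
    card_zeros_twistedForm_eq_card_iff (i := i) hF hK hJ hu (hm ▸ hpm) (hm ▸ hgcd) (g := g)
  have hσ0 : σ 0 = 0 := hzero.mp (by
    rw [Finset.filter_true_of_mem fun j _ => (hσ 0 j).mp (by simp), Finset.card_univ, hJ])
  have hE : Function.Injective E := by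
    intro g g' hg
    have hsub : σ (g - g') = 0 := hzero.mp (by
      rw [Finset.filter_true_of_mem, Finset.card_univ, hJ]
      refine fun j _ => (hσ (g - g') j).mp ?_
      rw [← sub_eq_zero.mpr (congrFun hg j), ← map_sub, Prod.fst_sub, Prod.snd_sub]
      congr 1
      ring)
    exact sub_eq_zero.mp (σ.injective (hsub.trans hσ0.symm))
  have hDE : D = Set.range E := by
    rw [hD]
    ext c
    constructor
    · rintro ⟨a, b, hc⟩
      exact ⟨(a, b), funext fun j => (hc j).symm⟩
    · rintro ⟨g, rfl⟩
      exact ⟨g.1, g.2, fun j => rfl⟩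
  have hcount {w k : ℕ} (hwk : w + k = p ^ s + 1) : {c ∈ D | hammingNorm c = w}.ncard =
      Finset.card {g : K × K | Finset.card {j : Fin (p ^ s + 1) |
        twistedForm F p s i g (γ ^ (j : ℕ)) (γ ^ (j : ℕ)) = 0} = k} := by
    rw [hDE, ncard_range_hammingNorm_eq hE hJ hwk]
    refine Finset.card_equiv σ fun g => ?_
    simp only [Finset.mem_filter, Finset.mem_univ, true_and, E, hσ]
  have hmem (g : K × K) : Finset.card {j : Fin (p ^ s + 1) |
      twistedForm F p s i g (γ ^ (j : ℕ)) (γ ^ (j : ℕ)) = 0} ∈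
      ({0, 1, 2, p ^ m + 1, p ^ s + 1} : Finset ℕ) := by
    by_cases hg : g = 0
    · rw [hzero.mpr hg]
      simp
    · have := card_zeros_twistedForm_mem (i := i) hF hK hJ hu hg
      rw [← hm] at this
      simp only [Finset.mem_insert, Finset.mem_singleton] at this ⊢
      tauto
  obtain ⟨hN, hN₂, hN₁, hN₀⟩ :=
    card_twistedForm_zeros (i := i) hF hK hJ hu rfl (congrArg (p ^ ·) hm) hpm hgcd
  rw [hcount (w := p ^ s - p ^ m) (k := p ^ m + 1) (by omega),
    hcount (w := p ^ s - 1) (k := 2) (by omega), hcount (w := p ^ s) (k := 1) rfl,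
    hcount (w := p ^ s + 1) (k := 0) rfl, hcount (w := 0) (k := p ^ s + 1) (zero_add _)]
  refine ⟨?_, hN₂, hN₁, hN₀, ?_, fun w hw => ?_⟩
  · rw [mul_comm 2 m, pow_mul]
    exact hN
  · exact Finset.card_eq_one.mpr ⟨0, by ext g; simpa using hzero⟩
  · simp only [Set.mem_insert_iff, Set.mem_singleton_iff, not_or] at hw
    by_cases hle : w ≤ p ^ s + 1
    · rw [hcount (Nat.add_sub_of_le hle), Finset.card_eq_zero, Finset.filter_eq_empty_iff]
      intro g _ hg
      have := hmem g
      rw [hg] at this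
      simp only [Finset.mem_insert, Finset.mem_singleton] at this
      omega
    · rw [Set.ncard_eq_zero]
      refine Set.eq_empty_of_forall_notMem fun c hc => hle ?_
      exact hc.2 ▸ hammingNorm_le_card_fintype.trans_eq hJ
end

section
/- Let q = 3^s with s > 1 an integer, let 0 < i < s with gcd(i, s) = 1, and let h = (q − 3^i)/2 or h = (3^i − 1)/2. Then the supports of the codewords of Hamming weight 4 in the BCH code C_h form a Steiner quadruple system S(3, 4, q+1): for every 3-element subset T of {0, 1, …, q}, there is exactly one 4-element subset S of {0, 1, …, q} with T ⊆ S such that S is the support of some codeword of C_h. -/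
/-- The coefficients `d` satisfy the four parity checks given by the monomials `1`, `X`, `X ^ Q`
and `X ^ (Q + 1)` evaluated at the points `x`. -/
def FourChecks {ι K : Type*} [Fintype ι] [Field K] (Q : ℕ) (x d : ι → K) : Prop :=
  ∑ j, d j = 0 ∧ ∑ j, d j * x j = 0 ∧ ∑ j, d j * x j ^ Q = 0 ∧ ∑ j, d j * x j ^ (Q + 1) = 0

theorem sum_eq_four {ι M : Type*} [Fintype ι] [DecidableEq ι] [AddCommMonoid M] {g : ι → M}
    {i j k l : ι} (hij : i ≠ j) (hik : i ≠ k) (hil : i ≠ l) (hjk : j ≠ k) (hjl : j ≠ l)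
    (hkl : k ≠ l) (hg : ∀ t, t ≠ i → t ≠ j → t ≠ k → t ≠ l → g t = 0) :
    ∑ t, g t = g i + g j + g k + g l := by
  rw [← Finset.sum_subset (Finset.subset_univ {i, j, k, l})]
  · rw [Finset.sum_insert (by simp [*]), Finset.sum_insert (by simp [*]),
      Finset.sum_insert (by simp [*]), Finset.sum_singleton]
    simp only [add_assoc]
  · intro t _ ht
    simp only [Finset.mem_insert, Finset.mem_singleton, not_or] at ht
    exact hg t ht.1 ht.2.1 ht.2.2.1 ht.2.2.2

/-- Two of the four coordinates can be eliminated from the parity checks. -/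
theorem FourChecks.eliminate {ι K : Type*} [Fintype ι] [DecidableEq ι] [Field K] {Q : ℕ}
    {x d : ι → K} (hd : FourChecks Q x d)
    {i j k l : ι} (hij : i ≠ j) (hik : i ≠ k) (hil : i ≠ l) (hjk : j ≠ k) (hjl : j ≠ l)
    (hkl : k ≠ l) (hg : ∀ t, t ≠ i → t ≠ j → t ≠ k → t ≠ l → d t = 0) :
    d k * ((x k - x i) * (x k ^ Q - x j ^ Q)) + d l * ((x l - x i) * (x l ^ Q - x j ^ Q)) = 0 := by
  obtain ⟨h0, h1, h2, h3⟩ := hd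
  rw [sum_eq_four hij hik hil hjk hjl hkl (fun t a b c e => by simp [hg t a b c e])]
    at h0 h1 h2 h3
  linear_combination h3 - x j ^ Q * h1 - x i * h2 + x i * x j ^ Q * h0

theorem pow_three_eq_self {K : Type*} [Field K] {s i : ℕ} (him : Nat.gcd i s = 1) {t : K}
    (hi : t ^ 3 ^ i = t) (hs : t ^ 3 ^ s = t) : t ^ 3 = t := by
  have key : ∀ n (y : K), (fun z : K => z ^ 3)^[n] y = y ^ 3 ^ n := by
    intro n
    induction n with
    | zero => simp
    | succ n ih => intro y; rw [Function.iterate_succ_apply, ih, ← pow_mul, pow_succ']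
  have h1 : Function.IsPeriodicPt (fun z : K => z ^ 3) i t := (key i t).trans hi
  have h2 : Function.IsPeriodicPt (fun z : K => z ^ 3) s t := (key s t).trans hs
  have h3 := h1.gcd h2
  rw [him] at h3
  simpa [Function.IsPeriodicPt, Function.IsFixedPt] using h3

theorem pow_eq_inv_of_pow_succ_eq_one {K : Type*} [Field K] {q : ℕ} {u : K}
    (hu : u ^ (q + 1) = 1) : u ^ q = u⁻¹ := by
  rw [pow_succ] at hu
  exact eq_inv_of_mul_eq_one_left hu

theorem ne_zero_of_pow_succ_eq_one {K : Type*} [Field K] {q : ℕ} {u : K}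
    (hu : u ^ (q + 1) = 1) : u ≠ 0 := by
  rintro rfl
  simp at hu

/-- Four points of the unit circle with a nontrivial relation are harmonic. -/
theorem harmonic_of_relation {K : Type*} [Field K] [CharP K 3] {s i : ℕ}
    (him : Nat.gcd i s = 1) {a b c d α γ : K}
    (ha : a ^ (3 ^ s + 1) = 1) (hb : b ^ (3 ^ s + 1) = 1) (hc : c ^ (3 ^ s + 1) = 1)
    (hd : d ^ (3 ^ s + 1) = 1) (hab : a ≠ b) (hac : a ≠ c) (had : a ≠ d) (hbc : b ≠ c)
    (hbd : b ≠ d) (hcd : c ≠ d) (hα : α ≠ 0)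
    (h1 : α * ((c - a) * (c ^ 3 ^ i - b ^ 3 ^ i)) + γ * ((d - a) * (d ^ 3 ^ i - b ^ 3 ^ i)) = 0)
    (h2 : α * ((c - b) * (c ^ 3 ^ i - a ^ 3 ^ i)) + γ * ((d - b) * (d ^ 3 ^ i - a ^ 3 ^ i)) = 0) :
    a * b + a * c + a * d + b * c + b * d + c * d = 0 := by
  have : Fact (Nat.Prime 3) := ⟨Nat.prime_three⟩
  have three : (3 : K) = 0 := by exact_mod_cast CharP.cast_eq_zero K 3
  have hcb : c - b ≠ 0 := sub_ne_zero.2 hbc.symm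
  have hda : d - a ≠ 0 := sub_ne_zero.2 had.symm
  have hD : (c - b) * (d - a) ≠ 0 := mul_ne_zero hcb hda
  rw [← sub_pow_char_pow, ← sub_pow_char_pow] at h1 h2
  have hi : ((c - a) * (d - b) / ((c - b) * (d - a))) ^ 3 ^ i
      = (c - a) * (d - b) / ((c - b) * (d - a)) := by
    rw [div_pow, div_eq_div_iff (pow_ne_zero _ hD) hD]
    apply mul_left_cancel₀ hα
    simp only [mul_pow]
    linear_combination (d - b) * (d - a) ^ 3 ^ i * h1 * (-1)
      + (d - a) * (d - b) ^ 3 ^ i * h2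
  have hs : ((c - a) * (d - b) / ((c - b) * (d - a))) ^ 3 ^ s
      = (c - a) * (d - b) / ((c - b) * (d - a)) := by
    have ha0 := ne_zero_of_pow_succ_eq_one ha
    have hb0 := ne_zero_of_pow_succ_eq_one hb
    have hc0 := ne_zero_of_pow_succ_eq_one hc
    have hd0 := ne_zero_of_pow_succ_eq_one hd
    have key : ∀ x y : K, x ^ (3 ^ s + 1) = 1 → y ^ (3 ^ s + 1) = 1 →
        (x - y) ^ 3 ^ s = (y - x) / (x * y) := by
      intro x y hx hy
      have := ne_zero_of_pow_succ_eq_one hx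
      have := ne_zero_of_pow_succ_eq_one hy
      rw [sub_pow_char_pow, pow_eq_inv_of_pow_succ_eq_one hx, pow_eq_inv_of_pow_succ_eq_one hy]
      field_simp
    rw [div_pow, mul_pow, mul_pow, key c a hc ha, key d b hd hb, key c b hc hb, key d a hd ha]
    have hbc' : b - c ≠ 0 := sub_ne_zero.2 hbc
    have had' : a - d ≠ 0 := sub_ne_zero.2 had
    field_simp
    ring
  have h3 := pow_three_eq_self him hi hs
  set t := (c - a) * (d - b) / ((c - b) * (d - a)) with ht
  have htD : t * ((c - b) * (d - a)) = (c - a) * (d - b) := by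
    rw [ht, div_mul_cancel₀ _ hD]
  have ht0 : t ≠ 0 := by
    rintro h0
    rw [h0, zero_mul] at htD
    exact mul_ne_zero (sub_ne_zero.2 hac.symm) (sub_ne_zero.2 hbd.symm) htD.symm
  have ht1 : t - 1 ≠ 0 := by
    intro h0
    have : (c - d) * (b - a) = 0 := by
      linear_combination htD - h0 * ((c - b) * (d - a))
    exact mul_ne_zero (sub_ne_zero.2 hcd) (sub_ne_zero.2 hab.symm) this
  have ht2 : t + 1 = 0 := by
    have : (t * (t - 1)) * (t + 1) = 0 := by linear_combination h3
    exact (mul_eq_zero.1 this).resolve_left (mul_ne_zero ht0 ht1)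
  linear_combination -ht2 * ((c - b) * (d - a)) + htD + (a * b + c * d) * three

/-- Harmonic quadruples carry a nontrivial relation. -/
theorem exists_relation_of_harmonic {K : Type*} [Field K] [CharP K 3] {a b c d : K} {i : ℕ}
    (h : a * b + a * c + a * d + b * c + b * d + c * d = 0) :
    ∃ v : Fin 4 → K, v ≠ 0 ∧ v 0 + v 1 + v 2 + v 3 = 0 ∧
      v 0 * a + v 1 * b + v 2 * c + v 3 * d = 0 ∧
      v 0 * a ^ 3 ^ i + v 1 * b ^ 3 ^ i + v 2 * c ^ 3 ^ i + v 3 * d ^ 3 ^ i = 0 ∧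
      v 0 * a ^ (3 ^ i + 1) + v 1 * b ^ (3 ^ i + 1) + v 2 * c ^ (3 ^ i + 1)
        + v 3 * d ^ (3 ^ i + 1) = 0 := by
  have : Fact (Nat.Prime 3) := ⟨Nat.prime_three⟩
  have three : (3 : K) = 0 := by exact_mod_cast CharP.cast_eq_zero K 3
  have H := congrArg (· ^ 3 ^ i) h
  simp only [add_pow_char_pow, mul_pow, zero_pow (pow_ne_zero i three_ne_zero)] at H
  simp only [pow_succ]
  generalize a ^ 3 ^ i = A at *
  generalize b ^ 3 ^ i = B at *
  generalize c ^ 3 ^ i = C at *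
  generalize d ^ 3 ^ i = D at *
  have hX : (c - a) * (d - b) + (c - b) * (d - a) = 0 := by
    linear_combination -h + (c * d + a * b) * three
  have hY : (C - A) * (D - B) + (C - B) * (D - A) = 0 := by
    linear_combination -H + (C * D + A * B) * three
  have hdet : (!![1, 1, 1, 1; a, b, c, d; A, B, C, D;
      A * a, B * b, C * c, D * d] : Matrix (Fin 4) (Fin 4) K).det = 0 := by
    have : (!![1, 1, 1, 1; a, b, c, d; A, B, C, D;
        A * a, B * b, C * c, D * d] : Matrix (Fin 4) (Fin 4) K).det
        = (c - a) * (d - b) * ((C - B) * (D - A)) - (c - b) * (d - a) * ((C - A) * (D - B)) := by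
      simp [Matrix.det_succ_row_zero, Fin.sum_univ_succ, Fin.succAbove]
      ring
    rw [this]
    linear_combination hX * ((C - B) * (D - A)) - (c - b) * (d - a) * hY
  obtain ⟨v, hv, hM⟩ := Matrix.exists_mulVec_eq_zero_iff.2 hdet
  refine ⟨v, hv, ?_, ?_, ?_, ?_⟩
  · simpa [Matrix.mulVec, dotProduct, Fin.sum_univ_four] using congrFun hM 0
  · simpa [Matrix.mulVec, dotProduct, Fin.sum_univ_four, mul_comm] using congrFun hM 1
  · simpa [Matrix.mulVec, dotProduct, Fin.sum_univ_four, mul_comm] using congrFun hM 2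
  · simpa [Matrix.mulVec, dotProduct, Fin.sum_univ_four, mul_comm] using congrFun hM 3

/-- Three distinct points of the unit circle have a harmonic fourth point on it. -/
theorem exists_harmonic {K : Type*} [Field K] [CharP K 3] {s : ℕ} {a b c : K}
    (ha : a ^ (3 ^ s + 1) = 1) (hb : b ^ (3 ^ s + 1) = 1) (hc : c ^ (3 ^ s + 1) = 1)
    (hab : a ≠ b) (hac : a ≠ c) (hbc : b ≠ c) :
    a + b + c ≠ 0 ∧ ∃ d : K, d ^ (3 ^ s + 1) = 1 ∧ d ≠ a ∧ d ≠ b ∧ d ≠ c ∧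
      a * b + a * c + a * d + b * c + b * d + c * d = 0 := by
  have : Fact (Nat.Prime 3) := ⟨Nat.prime_three⟩
  have three : (3 : K) = 0 := by exact_mod_cast CharP.cast_eq_zero K 3
  have ha0 := ne_zero_of_pow_succ_eq_one ha
  have hb0 := ne_zero_of_pow_succ_eq_one hb
  have hc0 := ne_zero_of_pow_succ_eq_one hc
  have h1 : (a + b + c) ^ 3 ^ s = (a * b + a * c + b * c) / (a * b * c) := by
    rw [add_pow_char_pow, add_pow_char_pow, pow_eq_inv_of_pow_succ_eq_one ha,
      pow_eq_inv_of_pow_succ_eq_one hb, pow_eq_inv_of_pow_succ_eq_one hc]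
    field_simp
    ring
  have h2 : (a * b + a * c + b * c) ^ 3 ^ s = (a + b + c) / (a * b * c) := by
    rw [add_pow_char_pow, add_pow_char_pow, mul_pow, mul_pow, mul_pow,
      pow_eq_inv_of_pow_succ_eq_one ha,
      pow_eq_inv_of_pow_succ_eq_one hb, pow_eq_inv_of_pow_succ_eq_one hc]
    field_simp
    ring
  have hs : a + b + c ≠ 0 := by
    intro h0
    have he : a * b + a * c + b * c = 0 := by
      rw [h0, zero_pow (pow_ne_zero s three_ne_zero), eq_comm, div_eq_zero_iff] at h1
      exact h1.resolve_right (by simp [ha0, hb0, hc0])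
    have : (a - b) * (a - c) = 0 := by
      linear_combination he + a * h0 - (a * b + a * c) * three
    exact mul_ne_zero (sub_ne_zero.2 hab) (sub_ne_zero.2 hac) this
  have he : a * b + a * c + b * c ≠ 0 := by
    intro h0
    rw [h0, zero_pow (pow_ne_zero s three_ne_zero), eq_comm, div_eq_zero_iff] at h2
    exact h2.elim hs (by simp [ha0, hb0, hc0])
  refine ⟨hs, -(a * b + a * c + b * c) / (a + b + c), ?_, ?_, ?_, ?_, ?_⟩
  · rw [pow_succ, div_pow, Odd.neg_pow ((by decide : Odd 3).pow), h1, h2]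
    have habc : a * b * c ≠ 0 := mul_ne_zero (mul_ne_zero ha0 hb0) hc0
    field_simp
    exact div_self (by convert he using 1; ring)
  · intro h
    rw [div_eq_iff hs] at h
    have : (a - b) * (a - c) = 0 := by
      linear_combination -h - (a * b + a * c) * three
    exact mul_ne_zero (sub_ne_zero.2 hab) (sub_ne_zero.2 hac) this
  · intro h
    rw [div_eq_iff hs] at h
    have : (b - a) * (b - c) = 0 := by
      linear_combination -h - (a * b + b * c) * three
    exact mul_ne_zero (sub_ne_zero.2 hab.symm) (sub_ne_zero.2 hbc) this
  · intro h
    rw [div_eq_iff hs] at h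
    have : (c - a) * (c - b) = 0 := by
      linear_combination -h - (a * c + b * c) * three
    exact mul_ne_zero (sub_ne_zero.2 hac.symm) (sub_ne_zero.2 hbc.symm) this
  · field_simp
    ring

/-- Up to a unit factor, the exponents `±h` and `±(h + 1)` are `0`, `1`, `3 ^ i`, `3 ^ i + 1`
modulo `q + 1`. -/
theorem exists_twist {K : Type*} [Field K] {q i h : ℕ} (hi : 3 ^ i ≤ q)
    (hh : 2 * h = q - 3 ^ i ∨ 2 * h = 3 ^ i - 1) :
    ∃ m : ℕ, ∀ {ι : Type} [Fintype ι] (x d : ι → K), (∀ j, x j ^ (q + 1) = 1) →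
      ((∑ j, d j * x j ^ m * x j ^ h = 0 ∧ ∑ j, d j * x j ^ m * x j ^ (h + 1) = 0 ∧
        ∑ j, d j * x j ^ m * x j ^ (q * h) = 0 ∧
        ∑ j, d j * x j ^ m * x j ^ (q * (h + 1)) = 0) ↔ FourChecks (3 ^ i) x d) := by
  have hQ : 0 < 3 ^ i := by positivity
  generalize 3 ^ i = Q at *
  have red : ∀ (u : K) (k e f : ℕ), u ^ (q + 1) = 1 → e = (q + 1) * k + f → u ^ e = u ^ f := by
    rintro u k e f hu rfl
    rw [pow_add, pow_mul, hu, one_pow, one_mul]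
  unfold FourChecks
  rcases hh with hh | hh
  · refine ⟨h + 1 + Q, fun x d hx => ?_⟩
    have e0 : ∀ j, d j * x j ^ (h + 1 + Q) * x j ^ h = d j := fun j => by
      rw [mul_assoc, ← pow_add, red (x j) 1 _ 0 (hx j) (by omega), pow_zero, mul_one]
    have e1 : ∀ j, d j * x j ^ (h + 1 + Q) * x j ^ (h + 1) = d j * x j := fun j => by
      rw [mul_assoc, ← pow_add, red (x j) 1 _ 1 (hx j) (by omega), pow_one]
    have e2 : ∀ j, d j * x j ^ (h + 1 + Q) * x j ^ (q * h) = d j * x j ^ (Q + 1) := fun j => by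
      rw [mul_assoc, ← pow_add, red (x j) h _ (Q + 1) (hx j) (by ring)]
    have e3 : ∀ j, d j * x j ^ (h + 1 + Q) * x j ^ (q * (h + 1)) = d j * x j ^ Q := fun j => by
      rw [mul_assoc, ← pow_add, red (x j) (h + 1) _ Q (hx j) (by ring)]
    simp only [e0, e1, e2, e3]
    tauto
  · refine ⟨h + 1, fun x d hx => ?_⟩
    have e0 : ∀ j, d j * x j ^ (h + 1) * x j ^ h = d j * x j ^ Q := fun j => by
      rw [mul_assoc, ← pow_add, red (x j) 0 _ Q (hx j) (by omega)]
    have e1 : ∀ j, d j * x j ^ (h + 1) * x j ^ (h + 1) = d j * x j ^ (Q + 1) := fun j => by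
      rw [mul_assoc, ← pow_add, red (x j) 0 _ (Q + 1) (hx j) (by omega)]
    have e2 : ∀ j, d j * x j ^ (h + 1) * x j ^ (q * h) = d j * x j := fun j => by
      rw [mul_assoc, ← pow_add, red (x j) h _ 1 (hx j) (by ring), pow_one]
    have e3 : ∀ j, d j * x j ^ (h + 1) * x j ^ (q * (h + 1)) = d j := fun j => by
      rw [mul_assoc, ← pow_add, red (x j) (h + 1) _ 0 (hx j) (by ring), pow_zero, mul_one]
    simp only [e0, e1, e2, e3]
    tauto

theorem FourChecks.ne_zero {ι K : Type*} [Fintype ι] [DecidableEq ι] [Field K] [CharP K 3]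
    {Q n : ℕ} (hQ : Q = 3 ^ n) {x d : ι → K} (hx : Function.Injective x) (hd : FourChecks Q x d)
    {i j k l : ι} (hij : i ≠ j) (hik : i ≠ k) (hil : i ≠ l) (hjk : j ≠ k) (hjl : j ≠ l)
    (hkl : k ≠ l) (hg : ∀ t, t ≠ i → t ≠ j → t ≠ k → t ≠ l → d t = 0) (hk : d k ≠ 0) :
    d l ≠ 0 := by
  have : Fact (Nat.Prime 3) := ⟨Nat.prime_three⟩
  intro hl
  have h := hd.eliminate hij hik hil hjk hjl hkl hg
  rw [hQ, ← sub_pow_char_pow, hl, zero_mul, add_zero] at h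
  exact mul_ne_zero hk (mul_ne_zero (sub_ne_zero.2 (hx.ne hik.symm))
    (pow_ne_zero _ (sub_ne_zero.2 (hx.ne hjk.symm)))) h

theorem sum_pow_mul_pow_eq_zero {ι K : Type*} [Fintype ι] [Field K] [CharP K 3] {s q e : ℕ}
    (hq : q = 3 ^ s) {x g : ι → K} (h : ∑ j, g j * x j ^ e = 0) :
    ∑ j, g j ^ q * x j ^ (q * e) = 0 := by
  have : Fact (Nat.Prime 3) := ⟨Nat.prime_three⟩
  have hpow := congrArg (· ^ 3 ^ s) h
  simp only [sum_pow_char_pow, zero_pow (pow_ne_zero s three_ne_zero), mul_pow] at hpow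
  simpa only [← hq, ← pow_mul, mul_comm q e] using hpow

/-- A solution over `K` of a Frobenius-stable system of checks yields one over `F`. -/
theorem exists_descent {ι F K : Type*} [Fintype ι] [Field F] [Field K] [Fintype F] [Fintype K]
    [Algebra F K] [CharP K 3] {s q h : ℕ} (hq : q = 3 ^ s) (hF : Fintype.card F = q)
    (hK : Fintype.card K = q ^ 2) {x g : ι → K} (hx : ∀ j, x j ^ (q + 1) = 1)
    (h0 : ∑ j, g j * x j ^ h = 0) (h1 : ∑ j, g j * x j ^ (h + 1) = 0)
    (h2 : ∑ j, g j * x j ^ (q * h) = 0) (h3 : ∑ j, g j * x j ^ (q * (h + 1)) = 0)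
    {k : ι} (hk : g k ≠ 0) :
    ∃ c : ι → F, c k ≠ 0 ∧ (∀ j, g j = 0 → c j = 0) ∧
      ∑ j, algebraMap F K (c j) * x j ^ h = 0 ∧
      ∑ j, algebraMap F K (c j) * x j ^ (h + 1) = 0 := by
  have : Fact (Nat.Prime 3) := ⟨Nat.prime_three⟩
  have three : (3 : K) = 0 := by exact_mod_cast CharP.cast_eq_zero K 3
  have hq1 : 1 < q := hF ▸ Fintype.one_lt_card
  have hrank : Module.finrank F K = 2 := by
    have := Module.card_eq_pow_finrank (K := F) (V := K)
    rw [hF, hK] at this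
    exact (Nat.pow_right_injective hq1 this).symm
  have htr : ∀ y : K, algebraMap F K (Algebra.trace F K y) = y + y ^ q := by
    intro y
    rw [FiniteField.algebraMap_trace_eq_sum_pow, hrank, Nat.card_eq_fintype_card, hF]
    simp [Finset.sum_range_succ]
  have hxx : ∀ j, (x j ^ q) ^ q = x j := fun j => by
    rw [pow_eq_inv_of_pow_succ_eq_one (hx j), inv_pow, pow_eq_inv_of_pow_succ_eq_one (hx j),
      inv_inv]
  have check : ∀ e : ℕ, ∑ j, g j * x j ^ e = 0 → ∑ j, g j * x j ^ (q * e) = 0 →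
      ∑ j, algebraMap F K (Algebra.trace F K ((g k)⁻¹ * g j)) * x j ^ e = 0 := by
    intro e he he'
    have hconj : ∑ j, g j ^ q * x j ^ e = 0 := by
      rw [← sum_pow_mul_pow_eq_zero hq he']
      refine Finset.sum_congr rfl fun j _ => ?_
      rw [pow_mul, pow_mul, hxx]
    calc _ = (g k)⁻¹ * ∑ j, g j * x j ^ e + ((g k)⁻¹) ^ q * ∑ j, g j ^ q * x j ^ e := by
          rw [Finset.mul_sum, Finset.mul_sum, ← Finset.sum_add_distrib]
          refine Finset.sum_congr rfl fun j _ => ?_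
          rw [htr, mul_pow]
          ring
      _ = 0 := by rw [he, hconj, mul_zero, mul_zero, add_zero]
  refine ⟨fun j => Algebra.trace F K ((g k)⁻¹ * g j), ?_, fun j hj => by simp [hj],
    check h h0 h2, check (h + 1) h1 h3⟩
  intro h4
  have h5 := htr ((g k)⁻¹ * g k)
  change Algebra.trace F K ((g k)⁻¹ * g k) = 0 at h4
  rw [h4, inv_mul_cancel₀ hk, map_zero, one_pow] at h5
  exact one_ne_zero (α := K) (by linear_combination three + h5)

/-- Coefficients in the small field satisfying the two defining checks satisfy all four. -/
theorem conjugate_check {ι F K : Type*} [Fintype ι] [Field F] [Field K] [Fintype F]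
    [Algebra F K] [CharP K 3] {s q e : ℕ} (hq : q = 3 ^ s) (hF : Fintype.card F = q)
    {x : ι → K} {c : ι → F} (h : ∑ j, algebraMap F K (c j) * x j ^ e = 0) :
    ∑ j, algebraMap F K (c j) * x j ^ (q * e) = 0 := by
  rw [← sum_pow_mul_pow_eq_zero hq h]
  refine Finset.sum_congr rfl fun j _ => ?_
  rw [← map_pow, ← hF, FiniteField.pow_card]

theorem stmt14 (s : ℕ) (hs : 1 < s) (q : ℕ) (hq : q = 3 ^ s)
    (i : ℕ) (hi0 : 0 < i) (his : i < s) (him : Nat.gcd i s = 1)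
    (h : ℕ) (hh : 2 * h = q - 3 ^ i ∨ 2 * h = 3 ^ i - 1)
    (F K : Type) [Field F] [Field K] [Fintype F] [Fintype K] [DecidableEq F]
    [Algebra F K] (hF : Fintype.card F = q) (hK : Fintype.card K = q ^ 2)
    (β : K) (hβ : IsPrimitiveRoot β (q + 1))
    (C : Set (Fin (q + 1) → F))
    (hC : C = {c | (∑ j : Fin (q + 1), algebraMap F K (c j) * β ^ (h * (j : ℕ)) = 0) ∧
      (∑ j : Fin (q + 1), algebraMap F K (c j) * β ^ ((h + 1) * (j : ℕ)) = 0)}) :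
    ∀ T : Finset (Fin (q + 1)), T.card = 3 →
      ∃! S : Finset (Fin (q + 1)), S.card = 4 ∧ T ⊆ S ∧
        ∃ c ∈ C, (Finset.univ.filter fun j => c j ≠ 0) = S := by
  subst hC
  have : Fact (Nat.Prime 3) := ⟨Nat.prime_three⟩
  have : CharP K 3 := charP_of_card_eq_prime_pow (f := s * 2) (by rw [hK, hq, pow_mul])
  have hQq : 3 ^ i ≤ q := hq ▸ Nat.pow_le_pow_right (by norm_num) his.le
  obtain ⟨m, hm⟩ := exists_twist (K := K) hQq hh
  set x : Fin (q + 1) → K := fun j => β ^ (j : ℕ) with hxdef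
  have hx : ∀ j, x j ^ (q + 1) = 1 := fun j => by
    rw [hxdef, ← pow_mul, mul_comm, pow_mul, hβ.pow_eq_one, one_pow]
  have hx0 : ∀ j, x j ≠ 0 := fun j => ne_zero_of_pow_succ_eq_one (hx j)
  have hinj : Function.Injective x := fun j k hjk => Fin.ext (hβ.pow_inj j.2 k.2 hjk)
  have hpow : ∀ (e : ℕ) (j : Fin (q + 1)), β ^ (e * (j : ℕ)) = x j ^ e := fun e j => by
    rw [hxdef, mul_comm, pow_mul]
  simp only [hpow, Set.mem_ofPred_eq]
  have hx' : ∀ j, x j ^ (3 ^ s + 1) = 1 := hq ▸ hx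
  have hcheck : ∀ c : Fin (q + 1) → F, ∑ j, algebraMap F K (c j) * x j ^ h = 0 →
      ∑ j, algebraMap F K (c j) * x j ^ (h + 1) = 0 →
      FourChecks (3 ^ i) x (fun j => algebraMap F K (c j) * (x j ^ m)⁻¹) := by
    intro c h0 h1
    rw [← hm x _ hx]
    simp only [inv_mul_cancel_right₀ (pow_ne_zero m (hx0 _))]
    exact ⟨h0, h1, conjugate_check hq hF h0, conjugate_check hq hF h1⟩
  intro T hT
  obtain ⟨j₁, j₂, j₃, h12, h13, h23, rfl⟩ := Finset.card_eq_three.1 hT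
  obtain ⟨hs0, y, hy, hy1, hy2, hy3, hharm⟩ :=
    exists_harmonic (hx' j₁) (hx' j₂) (hx' j₃) (hinj.ne h12) (hinj.ne h13) (hinj.ne h23)
  obtain ⟨n, hn, rfl⟩ := hβ.eq_pow_of_pow_eq_one (hq ▸ hy)
  obtain ⟨j₄, hj₄⟩ : ∃ j₄ : Fin (q + 1), β ^ n = x j₄ := ⟨⟨n, hn⟩, rfl⟩
  rw [hj₄] at hy1 hy2 hy3 hharm
  have h14 : j₁ ≠ j₄ := fun h => hy1 (h ▸ rfl)
  have h24 : j₂ ≠ j₄ := fun h => hy2 (h ▸ rfl)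
  have h34 : j₃ ≠ j₄ := fun h => hy3 (h ▸ rfl)
  refine ⟨{j₁, j₂, j₃, j₄}, ⟨?_, ?_, ?_⟩, ?_⟩
  · simp [h12, h13, h14, h23, h24, h34]
  · intro t ht
    simp only [Finset.mem_insert, Finset.mem_singleton] at ht ⊢
    rcases ht with e | e | e <;> simp [e]
  · obtain ⟨v, hv, e0, e1, e2, e3⟩ := exists_relation_of_harmonic (i := i) hharm
    set d : Fin (q + 1) → K := fun j =>
      if j = j₁ then v 0 else if j = j₂ then v 1 else if j = j₃ then v 2
      else if j = j₄ then v 3 else 0 with hd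
    have d1 : d j₁ = v 0 := by simp [hd]
    have d2 : d j₂ = v 1 := by simp [hd, h12.symm]
    have d3 : d j₃ = v 2 := by simp [hd, h13.symm, h23.symm]
    have d4 : d j₄ = v 3 := by simp [hd, h14.symm, h24.symm, h34.symm]
    have d5 : ∀ t, t ≠ j₁ → t ≠ j₂ → t ≠ j₃ → t ≠ j₄ → d t = 0 := by
      intro t _ _ _ _
      simp [*]
    have hsum : ∀ f : Fin (q + 1) → K,
        ∑ j, d j * f j = v 0 * f j₁ + v 1 * f j₂ + v 2 * f j₃ + v 3 * f j₄ := fun f => by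
      rw [sum_eq_four h12 h13 h14 h23 h24 h34
        (fun t a b c e => by rw [d5 t a b c e, zero_mul]), d1, d2, d3, d4]
    have hdc : FourChecks (3 ^ i) x d := by
      refine ⟨?_, (hsum _).trans e1, (hsum _).trans e2, (hsum _).trans e3⟩
      simpa using (hsum fun _ => 1).trans (by simpa using e0)
    obtain ⟨k, hk⟩ : ∃ k, d k ≠ 0 := by
      by_contra! hcon
      refine hv (funext fun r => ?_)
      fin_cases r
      · exact d1 ▸ hcon j₁
      · exact d2 ▸ hcon j₂
      · exact d3 ▸ hcon j₃
      · exact d4 ▸ hcon j₄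
    obtain ⟨g0, g1, g2, g3⟩ := (hm x d hx).2 hdc
    obtain ⟨c, hck, hc0, hc1, hc2⟩ := exists_descent hq hF hK hx g0 g1 g2 g3
      (mul_ne_zero hk (pow_ne_zero m (hx0 k)))
    refine ⟨c, ⟨hc1, hc2⟩, ?_⟩
    have hC := hcheck c hc1 hc2
    have hcd : ∀ j, c j ≠ 0 ↔ algebraMap F K (c j) * (x j ^ m)⁻¹ ≠ 0 := fun j => by
      simp [hx0 j]
    have hvan : ∀ t, t ≠ j₁ → t ≠ j₂ → t ≠ j₃ → t ≠ j₄ → c t = 0 := fun t a b e f =>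
      hc0 t (by rw [d5 t a b e f, zero_mul])
    have hvan' : ∀ t, t ≠ j₁ → t ≠ j₂ → t ≠ j₃ → t ≠ j₄ →
        algebraMap F K (c t) * (x t ^ m)⁻¹ = 0 := fun t a b e f => by
      rw [hvan t a b e f, map_zero, zero_mul]
    have i12 : c j₁ ≠ 0 ↔ c j₂ ≠ 0 := by
      rw [hcd, hcd]
      exact ⟨hC.ne_zero rfl hinj h34 h13.symm h23.symm h14.symm h24.symm h12
          (fun t a b e f => hvan' t e f a b),
        hC.ne_zero rfl hinj h34 h23.symm h13.symm h24.symm h14.symm h12.symm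
          (fun t a b e f => hvan' t f e a b)⟩
    have i34 : c j₃ ≠ 0 ↔ c j₄ ≠ 0 := by
      rw [hcd, hcd]
      exact ⟨hC.ne_zero rfl hinj h12 h13 h14 h23 h24 h34 hvan',
        hC.ne_zero rfl hinj h12 h14 h13 h24 h23 h34.symm
          (fun t a b e f => hvan' t a b f e)⟩
    have i23 : c j₂ ≠ 0 ↔ c j₃ ≠ 0 := by
      rw [hcd, hcd]
      exact ⟨hC.ne_zero rfl hinj h14 h12 h13 h24.symm h34.symm h23
          (fun t a b e f => hvan' t a e f b),
        hC.ne_zero rfl hinj h14 h13 h12 h34.symm h24.symm h23.symm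
          (fun t a b e f => hvan' t a f e b)⟩
    have hk4 : k = j₁ ∨ k = j₂ ∨ k = j₃ ∨ k = j₄ := by
      by_contra! hcon
      exact hk (d5 k hcon.1 hcon.2.1 hcon.2.2.1 hcon.2.2.2)
    have hall : c j₁ ≠ 0 ∧ c j₂ ≠ 0 ∧ c j₃ ≠ 0 ∧ c j₄ ≠ 0 := by
      have hc₁ : c j₁ ≠ 0 := by
        rcases hk4 with e | e | e | e <;> rw [e] at hck
        exacts [hck, i12.2 hck, i12.2 (i23.2 hck), i12.2 (i23.2 (i34.2 hck))]
      have hc₂ := i12.1 hc₁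
      have hc₃ := i23.1 hc₂
      exact ⟨hc₁, hc₂, hc₃, i34.1 hc₃⟩
    ext t
    simp only [Finset.mem_filter, Finset.mem_univ, true_and, Finset.mem_insert,
      Finset.mem_singleton]
    constructor
    · intro ht
      by_contra! hcon
      exact ht (hvan t hcon.1 hcon.2.1 hcon.2.2.1 hcon.2.2.2)
    · rintro (rfl | rfl | rfl | rfl)
      exacts [hall.1, hall.2.1, hall.2.2.1, hall.2.2.2]
  · rintro S ⟨hS, hTS, c, ⟨hc1, hc2⟩, rfl⟩
    obtain ⟨l, hlT, hlS⟩ := (Finset.exists_eq_insert_iff (s := {j₁, j₂, j₃})).2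
      ⟨hTS, by rw [hT, hS]⟩
    simp only [Finset.mem_insert, Finset.mem_singleton, not_or] at hlT
    obtain ⟨hl1, hl2, hl3⟩ := hlT
    have hsupp : ∀ t, c t ≠ 0 ↔ t = l ∨ t = j₁ ∨ t = j₂ ∨ t = j₃ := fun t => by
      have := Finset.ext_iff.1 hlS t
      simpa using this.symm
    have hC := hcheck c hc1 hc2
    have hvan : ∀ t, t ≠ j₁ → t ≠ j₂ → t ≠ j₃ → t ≠ l →
        algebraMap F K (c t) * (x t ^ m)⁻¹ = 0 := fun t a b e f => by
      have : c t = 0 := by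
        by_contra hcon
        rcases (hsupp t).1 hcon with g | g | g | g
        exacts [f g, a g, b g, e g]
      rw [this, map_zero, zero_mul]
    have r1 := hC.eliminate h12 h13 (Ne.symm hl1) h23 (Ne.symm hl2) (Ne.symm hl3) hvan
    have r2 := hC.eliminate h12.symm h23 (Ne.symm hl2) h13 (Ne.symm hl1) (Ne.symm hl3)
      (fun t a b e f => hvan t b a e f)
    have hc3 : algebraMap F K (c j₃) * (x j₃ ^ m)⁻¹ ≠ 0 := by
      have : c j₃ ≠ 0 := (hsupp j₃).2 (Or.inr (Or.inr (Or.inr rfl)))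
      simp [this, hx0 j₃]
    have hharm' := harmonic_of_relation him (hx' j₁) (hx' j₂) (hx' j₃) (hx' l) (hinj.ne h12)
      (hinj.ne h13) (hinj.ne (Ne.symm hl1)) (hinj.ne h23) (hinj.ne (Ne.symm hl2))
      (hinj.ne (Ne.symm hl3)) hc3 r1 r2
    have hl : l = j₄ := hinj (mul_right_cancel₀ hs0 (by linear_combination hharm' - hharm))
    subst hl
    rw [← hlS]
    ext t
    simp only [Finset.mem_insert, Finset.mem_singleton, or_comm, or_left_comm]
end
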